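/- Let X and Y be Polish spaces, t ≥ 1, and let C : X × P_t(Y) → ℝ ∪ {+∞} satisfy property (A). Then for every μ ∈ P(X) and ν ∈ P_t(Y), inf_{π ∈ Π(μ,ν)} ∫_X C(x,π_x) μ(dx) = sup_{g ∈ Φ_t(Y)} ( −ν(g) + ∫_X R_C g(x) μ(dx) ), where R_C g(x) = inf_{p ∈ P_t(Y)} ( p(g) + C(x,p) ); moreover the supremum is unchanged if it is restricted to those g ∈ Φ_t(Y) that are bounded from below. -/

import Mathlib

open MeasureTheory ProbabilityTheory ENNReal NNReal

noncomputable section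

/-- A probability measure has finite `t`-th moment. -/
def MemPt {Z : Type*} [MetricSpace Z] [MeasurableSpace Z] (t : ℝ)
    (p : ProbabilityMeasure Z) : Prop :=
  ∃ z₀ : Z, Integrable (fun z => dist z z₀ ^ t) (p : Measure Z)

/-- The class `Φ_t` of continuous functions with growth of order at most `t`. -/
def PhiT (t : ℝ) (Y : Type*) [MetricSpace Y] : Set (Y → ℝ) :=
  {g | Continuous g ∧ ∃ (K : ℝ) (y₀ : Y), ∀ y, |g y| ≤ K * (1 + dist y y₀ ^ t)}

/-- The space `𝒫_t(Y)` of probability measures with finite `t`-th moment. -/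
def PtSpace (t : ℝ) (Y : Type*) [MetricSpace Y] [MeasurableSpace Y] : Type _ :=
  {p : ProbabilityMeasure Y // MemPt t p}

/-- The `t`-Wasserstein topology on `𝒫_t(Y)`: the initial topology for the maps
`p ↦ ∫ g dp`, `g ∈ Φ_t(Y)`. -/
noncomputable instance (t : ℝ) (Y : Type*) [MetricSpace Y] [MeasurableSpace Y] :
    TopologicalSpace (PtSpace t Y) :=
  ⨅ g ∈ PhiT t Y,
    TopologicalSpace.induced
      (fun p : PtSpace t Y => ∫ y, g y ∂((p.1 : Measure Y))) inferInstance

variable {X Y : Type*} [MetricSpace X] [PolishSpace X] [MeasurableSpace X] [BorelSpace X]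
  [MetricSpace Y] [PolishSpace Y] [MeasurableSpace Y] [BorelSpace Y] [Nonempty Y]

/-- `π` is a coupling of `μ` and `ν`. -/
def IsCoupling (μ : ProbabilityMeasure X) (ν : ProbabilityMeasure Y)
    (π : ProbabilityMeasure (X × Y)) : Prop :=
  (π : Measure (X × Y)).map Prod.fst = (μ : Measure X) ∧
    (π : Measure (X × Y)).map Prod.snd = (ν : Measure Y)

/-- The disintegration `x ↦ π_x` of a coupling with respect to its first marginal,
as a map into probability measures. -/
noncomputable def disint (π : ProbabilityMeasure (X × Y)) (x : X) : ProbabilityMeasure Y :=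
  ⟨(π : Measure (X × Y)).condKernel x, inferInstance⟩

/-- The weak transport cost `∫ C(x, π_x) μ(dx)` of a coupling `π`. -/
noncomputable def weakCost (C : X → ProbabilityMeasure Y → ℝ≥0∞)
    (μ : ProbabilityMeasure X) (π : ProbabilityMeasure (X × Y)) : ℝ≥0∞ :=
  ∫⁻ x, C x (disint π x) ∂(μ : Measure X)

/-- The value of the weak transport problem (OWT). -/
noncomputable def weakValue (C : X → ProbabilityMeasure Y → ℝ≥0∞)
    (μ : ProbabilityMeasure X) (ν : ProbabilityMeasure Y) : ℝ≥0∞ :=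
  ⨅ (π : ProbabilityMeasure (X × Y)) (_ : IsCoupling μ ν π), weakCost C μ π

/-- The nonnegative part of an extended real number, as an element of `ℝ≥0∞`. -/
noncomputable def ERealToENNReal (x : EReal) : ℝ≥0∞ :=
  if x = ⊤ then ⊤ else ENNReal.ofReal x.toReal

/-- Integral of an `EReal`-valued function: positive part minus negative part. -/
noncomputable def eLintegral {α : Type*} [MeasurableSpace α] (m : Measure α)
    (f : α → EReal) : EReal :=
  ((∫⁻ a, ERealToENNReal (f a) ∂m : ℝ≥0∞) : EReal) -
    ((∫⁻ a, ERealToENNReal (-(f a)) ∂m : ℝ≥0∞) : EReal)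

/-- The inf-convolution operator `R_C g (x) = inf_{p ∈ 𝒫_t(Y)} (p(g) + C(x,p))`. -/
noncomputable def RC (t : ℝ) (C : X → ProbabilityMeasure Y → ℝ≥0∞)
    (g : Y → ℝ) (x : X) : EReal :=
  ⨅ (p : ProbabilityMeasure Y) (_ : MemPt t p),
    (((∫ y, g y ∂(p : Measure Y)) : ℝ) : EReal) + ((C x p : ℝ≥0∞) : EReal)

open Topology Filter in
/-- A nonnegative lower semicontinuous convex function, on a space whose topology is induced by a
pairing with a vector space, is the supremum of its affine minorants. -/
theorem exists_affine_minorant {Z F : Type*} [TopologicalSpace Z] [AddCommGroup F] [Module ℝ F]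
    (B : Z → F →ₗ[ℝ] ℝ) (hB : IsInducing (fun (z : Z) (f : F) => B z f))
    (V : Z → ℝ≥0∞) (hV : LowerSemicontinuous V)
    (hconv : ∀ (z₁ z₂ : Z) (a b : ℝ≥0), a + b = 1 →
      ∃ z, B z = (a : ℝ) • B z₁ + (b : ℝ) • B z₂ ∧ V z ≤ a * V z₁ + b * V z₂)
    (z₀ : Z) (α : ℝ) (hα : ENNReal.ofReal α < V z₀) :
    ∃ (f : F) (a : ℝ), (∀ z, ENNReal.ofReal (B z f + a) ≤ V z) ∧ α < B z₀ f + a := by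
  rcases lt_or_ge α 0 with hneg | hpos
  · exact ⟨0, 0, by simp, by simpa using hneg⟩
  let P : Module.Dual ℝ (F × ℝ) →ₗ[ℝ] (F × ℝ) →ₗ[ℝ] ℝ := LinearMap.id
  let j : Z × ℝ → WeakBilin P := fun q => (B q.1).coprod (q.2 • LinearMap.id)
  have hjapp : ∀ q f s, WeakBilin.eval P (f, s) (j q) = B q.1 f + q.2 * s := by
    intro q f s
    rfl
  have hj : IsInducing j := by
    have hcont : Continuous j := by
      refine WeakBilin.continuous_of_continuous_eval P fun fs => ?_
      change Continuous fun q : Z × ℝ => B q.1 fs.1 + q.2 * fs.2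
      have := (continuous_apply fs.1).comp hB.continuous
      exact (this.comp continuous_fst).add (continuous_snd.mul continuous_const)
    have hev : ∀ fs : F × ℝ, Continuous fun e : WeakBilin P => WeakBilin.eval P fs e :=
      fun fs => (WeakBilin.eval P fs).continuous
    let k : WeakBilin P → (F → ℝ) × ℝ :=
      fun e => (fun f => WeakBilin.eval P (f, 0) e, WeakBilin.eval P (0, 1) e)
    have hk : Continuous k :=
      (continuous_pi fun f => hev (f, 0)).prodMk (hev (0, 1))
    refine IsInducing.of_comp hcont hk ?_
    have : k ∘ j = Prod.map (fun (z : Z) (f : F) => B z f) id := by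
      funext q
      refine Prod.ext (funext fun f => ?_) ?_
      · simp [k, hjapp]
      · simp [k, hjapp]
    rw [this]
    exact hB.prodMap IsInducing.id
  let epi : Set (Z × ℝ) := {q | V q.1 ≤ ENNReal.ofReal q.2 ∧ 0 ≤ q.2}
  have hclosed : IsClosed epi := by
    have h1 : IsClosed {p : Z × ℝ≥0∞ | V p.1 ≤ p.2} := hV.isClosed_epigraph
    have h2 : Continuous fun q : Z × ℝ => (q.1, ENNReal.ofReal q.2) :=
      continuous_fst.prodMk (ENNReal.continuous_ofReal.comp continuous_snd)
    exact (h1.preimage h2).inter (isClosed_le continuous_const continuous_snd)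
  have hnot : j (z₀, α) ∉ closure (j '' epi) := by
    intro h
    have : (z₀, α) ∈ closure epi := by
      rw [hj.closure_eq_preimage_closure_image]; exact h
    rw [hclosed.closure_eq] at this
    exact absurd this.1 (not_le.2 hα)
  have hcvx : Convex ℝ (j '' epi) := by
    rintro _ ⟨⟨z₁, r₁⟩, ⟨h₁, h₁'⟩, rfl⟩ _ ⟨⟨z₂, r₂⟩, ⟨h₂, h₂'⟩, rfl⟩ a b ha hb hab
    lift a to ℝ≥0 using ha
    lift b to ℝ≥0 using hb
    obtain ⟨z, hz, hVz⟩ := hconv z₁ z₂ a b (by exact_mod_cast hab)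
    simp only at h₁ h₁' h₂ h₂'
    refine ⟨(z, a * r₁ + b * r₂), ⟨hVz.trans ?_, by positivity⟩, ?_⟩
    · simp only
      rw [ENNReal.ofReal_add (by positivity) (by positivity), ENNReal.ofReal_mul (by positivity),
        ENNReal.ofReal_mul (by positivity), ENNReal.ofReal_coe_nnreal, ENNReal.ofReal_coe_nnreal]
      gcongr
    · refine LinearMap.ext fun fs => ?_
      change B z fs.1 + (a * r₁ + b * r₂) * fs.2 =
        a * (B z₁ fs.1 + r₁ * fs.2) + b * (B z₂ fs.1 + r₂ * fs.2)
      rw [hz]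
      simp only [LinearMap.add_apply, LinearMap.smul_apply, smul_eq_mul]
      ring
  obtain ⟨φ, u, hu₀, hu⟩ := geometric_hahn_banach_point_closed hcvx.closure isClosed_closure hnot
  obtain ⟨⟨f, s⟩, rfl⟩ := LinearMap.dualEmbedding_surjective P φ
  rw [hjapp] at hu₀
  have hu' : ∀ z r, V z ≤ ENNReal.ofReal r → 0 ≤ r → u < B z f + r * s := by
    intro z r h h'
    have := hu _ (subset_closure ⟨(z, r), ⟨h, h'⟩, rfl⟩)
    rwa [hjapp] at this
  have hu'' : ∀ z, V z ≠ ⊤ → u < B z f + (V z).toReal * s := fun z hz =>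
    hu' z _ (by rw [ENNReal.ofReal_toReal hz]) ENNReal.toReal_nonneg
  simp only at hu₀
  by_cases hdom : ∃ z, V z ≠ ⊤
  swap
  · push Not at hdom
    exact ⟨0, α + 1, by simp [hdom], by simp⟩
  obtain ⟨z₁, hz₁⟩ := hdom
  have hs : 0 ≤ s := by
    by_contra! hs
    let r := max (V z₁).toReal ((u - B z₁ f) / s)
    have h1 := hu' z₁ r (by
      rw [← ENNReal.ofReal_toReal hz₁]; exact ENNReal.ofReal_le_ofReal (le_max_left _ _))
      (ENNReal.toReal_nonneg.trans (le_max_left _ _))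
    have h2 : r * s ≤ (u - B z₁ f) / s * s :=
      mul_le_mul_of_nonpos_right (le_max_right _ _) hs.le
    rw [div_mul_cancel₀ _ hs.ne] at h2
    linarith
  rcases hs.eq_or_lt with rfl | hs
  · simp only [mul_zero, add_zero] at hu₀ hu''
    have hd : 0 < u - B z₀ f := by linarith
    obtain ⟨k, hk⟩ := exists_nat_gt (α / (u - B z₀ f))
    refine ⟨-(k : ℝ) • f, k * u, fun z => ?_, ?_⟩
    · by_cases hz : V z = ⊤
      · simp [hz]
      rw [ENNReal.ofReal_of_nonpos]
      · exact zero_le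
      have := hu'' z hz
      simp only [map_smul, smul_eq_mul]
      nlinarith [(Nat.cast_nonneg k : (0 : ℝ) ≤ k)]
    · rw [div_lt_iff₀ hd] at hk
      simp only [map_smul, smul_eq_mul]
      linarith
  · refine ⟨-(s⁻¹) • f, s⁻¹ * u, fun z => ?_, ?_⟩
    · by_cases hz : V z = ⊤
      · simp [hz]
      rw [ENNReal.ofReal_le_iff_le_toReal hz]
      have := hu'' z hz
      simp only [map_smul, smul_eq_mul]
      have h3 : s⁻¹ * u < s⁻¹ * (B z f + (V z).toReal * s) := by gcongr
      have h4 : s⁻¹ * ((V z).toReal * s) = (V z).toReal := by field_simp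
      linarith
    · simp only [map_smul, smul_eq_mul]
      have h3 : s⁻¹ * (B z₀ f + α * s) < s⁻¹ * u := by gcongr
      have h4 : s⁻¹ * (α * s) = α := by field_simp
      linarith

section ProbabilityMeasureSpace

open Topology Filter unitInterval

variable {E : Type*} [TopologicalSpace E] [PolishSpace E] [MeasurableSpace E] [BorelSpace E]

theorem exists_measurableEmbedding_hilbertCube (E : Type*) [TopologicalSpace E] [PolishSpace E]
    [MeasurableSpace E] [BorelSpace E] :
    ∃ f : E → (ℕ → I), IsEmbedding f ∧ MeasurableEmbedding f := by
  let := TopologicalSpace.upgradeIsCompletelyMetrizable E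
  obtain ⟨f, hf⟩ := Metric.PiNatEmbed.exists_embedding_to_hilbert_cube (X := E)
  exact ⟨f, hf, hf.continuous.measurableEmbedding hf.injective⟩

theorem measurable_of_isOpen_lowerSemicontinuous {α : Type*} [MeasurableSpace α]
    (q : α → ProbabilityMeasure E)
    (hq : ∀ U : Set E, IsOpen U → Measurable fun a => (q a : Measure E) U) : Measurable q := by
  have : Measurable fun a => (q a : Measure E) :=
    Measurable.measure_of_isPiSystem_of_isProbabilityMeasure
    (BorelSpace.measurable_eq (α := E)) isPiSystem_isOpen hq
  exact this.subtype_mk (h := fun a => (q a).2)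

theorem lowerSemicontinuous_measure_isOpen {U : Set E} (hU : IsOpen U) :
    LowerSemicontinuous fun q : ProbabilityMeasure E => (q : Measure E) U := by
  rw [lowerSemicontinuous_iff_le_liminf]
  let := TopologicalSpace.upgradeIsCompletelyMetrizable E
  exact fun q => ProbabilityMeasure.le_liminf_measure_open_of_tendsto tendsto_id hU

theorem probabilityMeasure_le_borel :
    (inferInstance : MeasurableSpace (ProbabilityMeasure E)) ≤ borel (ProbabilityMeasure E) := by
  have h : @Measurable _ _ (borel (ProbabilityMeasure E)) _
      (id : ProbabilityMeasure E → ProbabilityMeasure E) := by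
    let := borel (ProbabilityMeasure E)
    have : BorelSpace (ProbabilityMeasure E) := ⟨rfl⟩
    exact @measurable_of_isOpen_lowerSemicontinuous E _ _ _ _ _ (borel (ProbabilityMeasure E)) id
      fun U hU => (lowerSemicontinuous_measure_isOpen hU).measurable
  exact fun s hs => h hs

theorem isEmbedding_map_probabilityMeasure {F : Type*} [TopologicalSpace F] [PolishSpace F]
    [MeasurableSpace F] [BorelSpace F] {f : E → F} (hf : IsEmbedding f) :
    IsEmbedding fun q : ProbabilityMeasure E =>
      q.map (hf.continuous.measurable.aemeasurable (μ := (q : Measure E))) := by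
  let := TopologicalSpace.upgradeIsCompletelyMetrizable E
  let := TopologicalSpace.upgradeIsCompletelyMetrizable F
  have hm : MeasurableEmbedding f := hf.continuous.measurableEmbedding hf.injective
  refine ⟨⟨le_antisymm ?_ ?_⟩, ?_⟩
  · exact continuous_iff_le_induced.1 (ProbabilityMeasure.continuous_map hf.continuous)
  · rw [le_iff_nhds]
    intro q
    rw [nhds_induced]
    refine tendsto_of_forall_isOpen_le_liminf' (μs := fun q => q) (L := comap _ (𝓝 _))
      fun G hG => ?_
    obtain ⟨V, hV, rfl⟩ := hf.isOpen_iff.1 hG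
    have := ProbabilityMeasure.le_liminf_measure_open_of_tendsto (tendsto_comap
      (f := fun q : ProbabilityMeasure E =>
        q.map (hf.continuous.measurable.aemeasurable (μ := (q : Measure E)))) (x := 𝓝 _)) hV
      (μ := q.map (hf.continuous.measurable.aemeasurable (μ := (q : Measure E))))
    simpa [Measure.map_apply hf.continuous.measurable hV.measurableSet] using this
  · intro p q hpq
    have h := congrArg (fun q : ProbabilityMeasure F => (q : Measure F)) hpq
    simp only [ProbabilityMeasure.toMeasure_map] at h
    ext s hs
    have := congrArg (fun m : Measure F => m (f '' s)) h
    simpa [hm.map_apply, hf.injective.preimage_image] using this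

instance countablySeparated_probabilityMeasure :
    MeasurableSpace.CountablySeparated (ProbabilityMeasure E) := by
  have hgen := MeasurableSpace.generateFrom_countableGeneratingSet (α := E)
  set A := generateSetAlgebra (MeasurableSpace.countableGeneratingSet E) with hA
  have hAc : A.Countable :=
    countable_generateSetAlgebra MeasurableSpace.countable_countableGeneratingSet
  have hAg : ‹MeasurableSpace E› = MeasurableSpace.generateFrom A := by
    rw [hA, generateFrom_generateSetAlgebra_eq, hgen]
  have hAm : ∀ s ∈ A, MeasurableSet s := fun s hs => by
    rw [hAg]; exact MeasurableSpace.measurableSet_generateFrom hs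
  have : Countable A := hAc
  let F : ProbabilityMeasure E → A → ℝ≥0∞ := fun q s => (q : Measure E) s
  have hFm : Measurable F := measurable_pi_lambda _ fun s =>
    (Measure.measurable_coe (hAm s s.2)).comp measurable_subtype_coe
  have hFi : Function.Injective F := fun p q hpq => Subtype.ext <|
    show (p : Measure E) = q from ext_of_generate_finite A hAg
      isSetAlgebra_generateSetAlgebra.isSetRing.isSetSemiring.isPiSystem
      (fun s hs => congrFun hpq ⟨s, hs⟩) (by simp)
  obtain ⟨S, hSc, hSm, hS⟩ :=
    exists_countable_separating (A → ℝ≥0∞) MeasurableSet Set.univ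
  refine ⟨⟨(F ⁻¹' ·) '' S, hSc.image _, ?_, fun p _ q _ hpq => hFi ?_⟩⟩
  · rintro _ ⟨s, hs, rfl⟩
    exact hFm (hSm s hs)
  · exact hS _ trivial _ trivial fun s hs => hpq _ ⟨s, hs, rfl⟩

instance secondCountable_probabilityMeasure :
    SecondCountableTopology (ProbabilityMeasure E) := by
  obtain ⟨f, hf, hm⟩ := exists_measurableEmbedding_hilbertCube E
  have : SecondCountableTopology (ProbabilityMeasure (ℕ → I)) := by
    let := TopologicalSpace.metrizableSpaceMetric (ProbabilityMeasure (ℕ → I))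
    infer_instance
  exact (isEmbedding_map_probabilityMeasure hf).secondCountableTopology

theorem borelSpace_probabilityMeasure_of_compact [CompactSpace E] :
    BorelSpace (ProbabilityMeasure E) := by
  have : PolishSpace (ProbabilityMeasure E) := by
    let := TopologicalSpace.metrizableSpaceMetric (ProbabilityMeasure E)
    infer_instance
  refine ⟨le_antisymm probabilityMeasure_le_borel ?_⟩
  have hid : @MeasurableEmbedding _ _ (borel (ProbabilityMeasure E)) _
      (id : ProbabilityMeasure E → ProbabilityMeasure E) := by
    refine @Measurable.measurableEmbedding _ _ _ _ _ (borel (ProbabilityMeasure E)) ?_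
      (fun s hs => probabilityMeasure_le_borel s hs) Function.injective_id
    let := borel (ProbabilityMeasure E)
    have : BorelSpace (ProbabilityMeasure E) := ⟨rfl⟩
    infer_instance
  intro s hs
  simpa using @MeasurableEmbedding.measurableSet_image' _ _ (borel _) _ _ hid s hs

theorem measurableEmbedding_map_probabilityMeasure {F : Type*} [MeasurableSpace F] {f : E → F}
    (hf : MeasurableEmbedding f) :
    MeasurableEmbedding fun q : ProbabilityMeasure E =>
      q.map (hf.measurable.aemeasurable (μ := (q : Measure E))) := by
  set M := fun q : ProbabilityMeasure E =>
      q.map (hf.measurable.aemeasurable (μ := (q : Measure E))) with hM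
  have hMm : Measurable M :=
    ((Measure.measurable_map f hf.measurable).comp measurable_subtype_coe).subtype_mk
  have happ : ∀ q s, (M q : Measure F) (f '' s) = (q : Measure E) s := fun q s => by
    simp [hM, hf.map_apply, hf.injective.preimage_image]
  have hMi : Function.Injective M := fun p q hpq => Subtype.ext <| by
    change (p : Measure E) = q
    ext s _
    rw [← happ, ← happ, hpq]
  have hrange : Set.range M = {q : ProbabilityMeasure F | (q : Measure F) (Set.range f) = 1} := by
    ext q
    constructor
    · rintro ⟨p, rfl⟩
      simpa using happ p Set.univ
    · intro hq
      have hmap : ((q : Measure F).comap f).map f = q := by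
        rw [hf.map_comap]
        refine Measure.restrict_eq_self_of_ae_mem ?_
        exact (mem_ae_iff_prob_eq_one hf.measurableSet_range).2 hq
      refine ⟨⟨(q : Measure F).comap f, ⟨?_⟩⟩, Subtype.ext hmap⟩
      rw [hf.comap_apply, Set.image_univ]
      exact hq
  have hle : (inferInstance : MeasurableSpace (ProbabilityMeasure E)) ≤
      MeasurableSpace.comap M inferInstance := by
    have hid : @Measurable _ _ (MeasurableSpace.comap M inferInstance) _
        (id : ProbabilityMeasure E → ProbabilityMeasure E) := by
      suffices h : @Measurable _ _ (MeasurableSpace.comap M inferInstance) _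
          (fun q : ProbabilityMeasure E => (q : Measure E)) from
        h.subtype_mk (h := fun q => q.2)
      refine @Measure.measurable_of_measurable_coe _ _ _ (MeasurableSpace.comap M inferInstance)
        _ ?_
      intro s hs
      simp only [← happ _ s]
      exact ((Measure.measurable_coe (hf.measurableSet_image' hs)).comp
        measurable_subtype_coe).comp (comap_measurable M)
    exact fun s hs => hid hs
  refine ⟨hMi, hMm, fun {s} hs => ?_⟩
  obtain ⟨s', hs', rfl⟩ := hle s hs
  rw [Set.image_preimage_eq_inter_range, hrange]
  exact hs'.inter (((Measure.measurable_coe hf.measurableSet_range).comp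
    measurable_subtype_coe) (measurableSet_singleton 1))

instance borelSpace_probabilityMeasure : BorelSpace (ProbabilityMeasure E) := by
  obtain ⟨f, hf, hm⟩ := exists_measurableEmbedding_hilbertCube E
  have := borelSpace_probabilityMeasure_of_compact (E := ℕ → I)
  exact (measurableEmbedding_map_probabilityMeasure hm).borelSpace
    (isEmbedding_map_probabilityMeasure hf).isInducing

theorem _root_.MeasurableEquiv.standardBorelSpace {α β : Type*} [MeasurableSpace α]
    [MeasurableSpace β] [StandardBorelSpace β] (e : α ≃ᵐ β) : StandardBorelSpace α := by
  let := upgradeStandardBorel β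
  let τ : TopologicalSpace α := TopologicalSpace.induced e inferInstance
  have hτ : IsInducing e := ⟨rfl⟩
  have hb : @BorelSpace _ τ _ := e.measurableEmbedding.borelSpace hτ
  exact ⟨τ, hb, (e.toEquiv.toHomeomorphOfIsInducing hτ).isClosedEmbedding.polishSpace⟩

instance standardBorelSpace_probabilityMeasure : StandardBorelSpace (ProbabilityMeasure E) := by
  obtain ⟨f, hf, hm⟩ := exists_measurableEmbedding_hilbertCube E
  have := borelSpace_probabilityMeasure_of_compact (E := ℕ → I)
  have : PolishSpace (ProbabilityMeasure (ℕ → I)) := by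
    let := TopologicalSpace.metrizableSpaceMetric (ProbabilityMeasure (ℕ → I))
    infer_instance
  have he := measurableEmbedding_map_probabilityMeasure hm
  have := he.measurableSet_range.standardBorel
  exact he.equivRange.standardBorelSpace

end ProbabilityMeasureSpace

section WeakConvergence

open Topology Filter

variable {E : Type*} [TopologicalSpace E] [PolishSpace E] [MeasurableSpace E] [BorelSpace E]

theorem lintegral_le_liminf_lintegral_of_lowerSemicontinuous {E : Type*} [TopologicalSpace E]
    [MeasurableSpace E] [BorelSpace E] [HasOuterApproxClosed E] {f : E → ℝ≥0∞}
    (hf : LowerSemicontinuous f) {p : ProbabilityMeasure E} {ps : ℕ → ProbabilityMeasure E}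
    (hp : Tendsto ps atTop (𝓝 p)) :
    ∫⁻ a, f a ∂(p : Measure E) ≤ liminf (fun n => ∫⁻ a, f a ∂(ps n : Measure E)) atTop := by
  have hopen : ∀ (N : ℕ) (t : ℝ), 0 < t → IsOpen {a | t < (min (f a) N).toReal} := by
    intro N t ht
    have : {a | t < (min (f a) N).toReal} = {a | ENNReal.ofReal t < f a} ∩
        {a | ENNReal.ofReal t < (N : ℝ≥0∞)} := by
      ext a
      have hne : min (f a) N ≠ ⊤ := ne_top_of_le_ne_top (natCast_ne_top N) (min_le_right _ _)
      simp [← ENNReal.ofReal_lt_iff_lt_toReal ht.le hne]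
    rw [this]
    exact (hf.isOpen_preimage _).inter isOpen_const
  have hmeas : ∀ N : ℕ, Measurable fun a => min (f a) (N : ℝ≥0∞) := fun N =>
    hf.measurable.min measurable_const
  have hlayer : ∀ (N : ℕ) (q : ProbabilityMeasure E), ∫⁻ a, min (f a) N ∂(q : Measure E) =
      ∫⁻ t in Set.Ioi (0 : ℝ), (q : Measure E) {a | t < (min (f a) N).toReal} := by
    intro N q
    rw [← lintegral_eq_lintegral_meas_lt _ (Eventually.of_forall fun _ => toReal_nonneg)
      (hmeas N).ennreal_toReal.aemeasurable]
    refine lintegral_congr fun a => (ofReal_toReal ?_).symm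
    exact ne_top_of_le_ne_top (natCast_ne_top N) (min_le_right _ _)
  have hN : ∀ N : ℕ, ∫⁻ a, min (f a) N ∂(p : Measure E) ≤
      liminf (fun n => ∫⁻ a, f a ∂(ps n : Measure E)) atTop := by
    intro N
    calc ∫⁻ a, min (f a) N ∂(p : Measure E)
        ≤ ∫⁻ t in Set.Ioi (0 : ℝ), liminf (fun n =>
            (ps n : Measure E) {a | t < (min (f a) N).toReal}) atTop := by
          rw [hlayer]
          exact setLIntegral_mono' measurableSet_Ioi fun t ht =>
            ProbabilityMeasure.le_liminf_measure_open_of_tendsto hp (hopen N t ht)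
      _ ≤ liminf (fun n => ∫⁻ t in Set.Ioi (0 : ℝ),
            (ps n : Measure E) {a | t < (min (f a) N).toReal}) atTop :=
          lintegral_liminf_le fun n => Antitone.measurable fun s t hst =>
            measure_mono fun ω hω => lt_of_le_of_lt hst hω
      _ = liminf (fun n => ∫⁻ a, min (f a) N ∂(ps n : Measure E)) atTop := by simp [hlayer]
      _ ≤ _ := liminf_le_liminf (Eventually.of_forall fun n =>
          lintegral_mono fun a => min_le_left _ _)
  have hsup : ∀ a, f a = ⨆ N : ℕ, min (f a) N := by
    intro a
    refine le_antisymm (le_of_forall_lt fun c hc => ?_) (iSup_le fun _ => min_le_left _ _)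
    obtain ⟨N, hN⟩ := ENNReal.exists_nat_gt (ne_top_of_lt hc)
    exact lt_iSup_iff.2 ⟨N, lt_min hc hN⟩
  calc ∫⁻ a, f a ∂(p : Measure E) = ∫⁻ a, ⨆ N : ℕ, min (f a) N ∂(p : Measure E) :=
        lintegral_congr hsup
    _ = ⨆ N : ℕ, ∫⁻ a, min (f a) N ∂(p : Measure E) :=
        lintegral_iSup hmeas fun M N hMN a => by
          simp only
          gcongr
    _ ≤ _ := iSup_le hN

theorem exists_isCompact_compl_le_of_tendsto {p : ProbabilityMeasure E}
    {ps : ℕ → ProbabilityMeasure E} (hp : Tendsto ps atTop (𝓝 p)) {ε : ℝ≥0∞} (hε : 0 < ε) :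
    ∃ K : Set E, IsCompact K ∧ ∀ n, (ps n : Measure E) Kᶜ ≤ ε := by
  let := TopologicalSpace.upgradeIsCompletelyMetrizable E
  have hc := hp.isCompact_insert_range
  obtain ⟨K, hK, h⟩ := isTightMeasureSet_iff_exists_isCompact_measure_compl_le.1
    (isTightMeasureSet_of_isCompact_closure (by rwa [hc.isClosed.closure_eq])) ε hε
  exact ⟨K, hK, fun n => h _ ⟨ps n, Or.inr ⟨n, rfl⟩, rfl⟩⟩

/-- A set of random measures is tight as soon as its intensities are tight. -/
theorem isTightMeasureSet_of_intensity {S : Set (Measure (ProbabilityMeasure E))}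
    (hS : ∀ ε : ℝ≥0∞, 0 < ε → ∃ K : Set E, IsCompact K ∧
      ∀ P ∈ S, ∫⁻ q, (q : Measure E) Kᶜ ∂P ≤ ε) :
    IsTightMeasureSet S := by
  let := TopologicalSpace.upgradeIsCompletelyMetrizable E
  rw [isTightMeasureSet_iff_exists_isCompact_measure_compl_le]
  intro ε hε
  obtain ⟨c, hc, hcs⟩ := ENNReal.exists_pos_sum_of_countable' hε.ne' ℕ
  obtain ⟨u, -, u_pos, u_lim⟩ :
      ∃ u : ℕ → ℝ≥0, StrictAnti u ∧ (∀ n, 0 < u n) ∧ Tendsto u atTop (𝓝 0) :=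
    exists_seq_strictAnti_tendsto 0
  choose K hK hKP using fun k => hS (c k * u k)
    (ENNReal.mul_pos (hc k).ne' (by simpa using (u_pos k).ne'))
  refine ⟨_, isCompact_setOfPred_probabilityMeasure_mass_eq_compl_isCompact_le u_lim hK
    (Or.inl inferInstance), fun P hP => ?_⟩
  have hsub : {q : ProbabilityMeasure E | ∀ n, q (K n)ᶜ ≤ u n}ᶜ ⊆
      ⋃ n, {q : ProbabilityMeasure E | (u n : ℝ≥0∞) ≤ (q : Measure E) (K n)ᶜ} := by
    intro q hq
    simp only [Set.mem_compl_iff, Set.mem_ofPred_eq, not_forall, not_le] at hq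
    obtain ⟨n, hn⟩ := hq
    refine Set.mem_iUnion.2 ⟨n, ?_⟩
    rw [Set.mem_ofPred_eq, ← ProbabilityMeasure.ennreal_coeFn_eq_coeFn_toMeasure]
    exact_mod_cast hn.le
  refine (measure_mono hsub).trans ((measure_iUnion_le _).trans ?_)
  refine (ENNReal.tsum_le_tsum fun n => ?_).trans hcs.le
  refine (meas_ge_le_lintegral_div (μ := P)
      (f := fun q : ProbabilityMeasure E => (q : Measure E) (K n)ᶜ)
    ?_ (by simpa using (u_pos n).ne') coe_ne_top).trans ?_
  · exact ((Measure.measurable_coe (hK n).measurableSet.compl).comp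
      measurable_subtype_coe).aemeasurable
  · exact ENNReal.div_le_of_le_mul (hKP n P hP)

theorem exists_subseq_tendsto_of_intensity {F : Type*} [TopologicalSpace F] [PolishSpace F]
    [MeasurableSpace F] [BorelSpace F] (P : ℕ → ProbabilityMeasure (F × ProbabilityMeasure E))
    (h₁ : ∀ ε : ℝ≥0∞, 0 < ε → ∃ K : Set F, IsCompact K ∧
      ∀ n, (P n : Measure (F × ProbabilityMeasure E)).map Prod.fst Kᶜ ≤ ε)
    (h₂ : ∀ ε : ℝ≥0∞, 0 < ε → ∃ K : Set E, IsCompact K ∧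
      ∀ n, ∫⁻ z, (z.2 : Measure E) Kᶜ ∂(P n : Measure (F × ProbabilityMeasure E)) ≤ ε) :
    ∃ Q : ProbabilityMeasure (F × ProbabilityMeasure E), ∃ φ : ℕ → ℕ, StrictMono φ ∧
      Tendsto (P ∘ φ) atTop (𝓝 Q) := by
  let := TopologicalSpace.upgradeIsCompletelyMetrizable F
  let := TopologicalSpace.upgradeIsCompletelyMetrizable E
  have htight : IsTightMeasureSet
      {((μ : ProbabilityMeasure (F × ProbabilityMeasure E)) :
        Measure (F × ProbabilityMeasure E)) | μ ∈ Set.range P} := by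
    refine IsTightMeasureSet.prodMk ?_ ?_
    · rw [isTightMeasureSet_iff_exists_isCompact_measure_compl_le]
      intro ε hε
      obtain ⟨K, hK, h⟩ := h₁ ε hε
      refine ⟨K, hK, ?_⟩
      rintro _ ⟨_, ⟨_, ⟨n, rfl⟩, rfl⟩, rfl⟩
      exact h n
    · refine isTightMeasureSet_of_intensity fun ε hε => ?_
      obtain ⟨K, hK, h⟩ := h₂ ε hε
      refine ⟨K, hK, ?_⟩
      rintro _ ⟨_, ⟨_, ⟨n, rfl⟩, rfl⟩, rfl⟩
      refine le_of_eq_of_le (lintegral_map ?_ measurable_snd) (h n)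
      exact (Measure.measurable_coe hK.measurableSet.compl).comp measurable_subtype_coe
  have hcomp := isCompact_closure_of_isTightMeasureSet htight
  have : FirstCountableTopology (ProbabilityMeasure (F × ProbabilityMeasure E)) := by
    infer_instance
  obtain ⟨Q, -, φ, hφ, h⟩ := hcomp.tendsto_subseq fun n => subset_closure ⟨n, rfl⟩
  exact ⟨Q, φ, hφ, h⟩

end WeakConvergence

section Untilt

open Topology Filter BoundedContinuousFunction

variable {E : Type*} [TopologicalSpace E] [PolishSpace E] [MeasurableSpace E] [BorelSpace E]

/-- The bounded continuous function `exp (-v)`, for `v` nonnegative and continuous. -/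
def expNeg (v : C(E, ℝ≥0)) : E →ᵇ ℝ :=
  BoundedContinuousFunction.ofNormedAddCommGroup (fun y => Real.exp (-(v y : ℝ)))
    (by fun_prop) 1 fun y => by simp

theorem expNeg_apply (v : C(E, ℝ≥0)) (y : E) : expNeg v y = Real.exp (-(v y : ℝ)) := rfl

theorem integrable_bcf (q : ProbabilityMeasure E) (f : E →ᵇ ℝ) : Integrable f (q : Measure E) := by
  let := TopologicalSpace.upgradeIsCompletelyMetrizable E
  exact f.integrable _

theorem continuous_integral_bcf (f : E →ᵇ ℝ) :
    Continuous fun q : ProbabilityMeasure E => ∫ y, f y ∂(q : Measure E) :=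
  continuous_iff_continuousAt.2 fun _ =>
    ProbabilityMeasure.tendsto_iff_forall_integral_tendsto.1 tendsto_id f

theorem integral_expNeg_pos (v : C(E, ℝ≥0)) (q : ProbabilityMeasure E) :
    0 < ∫ y, expNeg v y ∂(q : Measure E) :=
  integral_exp_pos (integrable_bcf q (expNeg v))

theorem integral_expNeg_le_one (v : C(E, ℝ≥0)) (q : ProbabilityMeasure E) :
    ∫ y, expNeg v y ∂(q : Measure E) ≤ 1 := by
  have := integral_mono (integrable_bcf q (expNeg v)) (integrable_const (1 : ℝ)) fun y => by
    simp [expNeg_apply]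
  simpa using this

/-- The probability measure with density proportional to `exp (-v)` with respect to `q`. -/
def untilt (v : C(E, ℝ≥0)) (q : ProbabilityMeasure E) : ProbabilityMeasure E :=
  ⟨(q : Measure E).tilted fun y => -(v y : ℝ), isProbabilityMeasure_tilted
    (integrable_bcf q (expNeg v))⟩

theorem toMeasure_untilt (v : C(E, ℝ≥0)) (q : ProbabilityMeasure E) :
    (untilt v q : Measure E) = (q : Measure E).tilted fun y => -(v y : ℝ) := rfl

theorem integral_untilt (v : C(E, ℝ≥0)) (q : ProbabilityMeasure E) (g : E → ℝ) :
    ∫ y, g y ∂(untilt v q : Measure E) =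
      (∫ y, g y * expNeg v y ∂(q : Measure E)) / ∫ y, expNeg v y ∂(q : Measure E) := by
  rw [toMeasure_untilt, integral_tilted, ← integral_div]
  refine integral_congr_ae (Eventually.of_forall fun y => ?_)
  simp only [smul_eq_mul, expNeg_apply]
  ring

/-- The product of `exp (-v)` with a continuous function of growth at most `exp v`. -/
def mulExpNeg (v : C(E, ℝ≥0)) (g : E → ℝ) (hg : Continuous g) (K : ℝ)
    (hK : ∀ y, |g y| ≤ K * Real.exp (v y)) : E →ᵇ ℝ :=
  BoundedContinuousFunction.ofNormedAddCommGroup (fun y => g y * expNeg v y) (by fun_prop) K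
    fun y => by
      rw [Real.norm_eq_abs, abs_mul, expNeg_apply, Real.abs_exp, Real.exp_neg,
        ← div_eq_mul_inv, div_le_iff₀ (Real.exp_pos _)]
      exact hK y

theorem continuous_integral_untilt (v : C(E, ℝ≥0)) {g : E → ℝ} (hg : Continuous g) {K : ℝ}
    (hK : ∀ y, |g y| ≤ K * Real.exp (v y)) :
    Continuous fun q : ProbabilityMeasure E => ∫ y, g y ∂(untilt v q : Measure E) := by
  simp only [integral_untilt]
  exact (continuous_integral_bcf (mulExpNeg v g hg K hK)).div
    (continuous_integral_bcf (expNeg v)) fun q => (integral_expNeg_pos v q).ne'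

theorem continuous_untilt (v : C(E, ℝ≥0)) : Continuous (untilt v) := by
  refine continuous_iff_continuousAt.2 fun q =>
    ProbabilityMeasure.tendsto_iff_forall_integral_tendsto.2 fun f => ?_
  refine (continuous_integral_untilt v f.continuous (K := ‖f‖) fun y => ?_).continuousAt
  refine (f.norm_coe_le_norm y).trans (le_mul_of_one_le_right (norm_nonneg f) ?_)
  exact Real.one_le_exp (v y).2

theorem measurable_untilt (v : C(E, ℝ≥0)) : Measurable (untilt v) :=
  (continuous_untilt v).measurable

theorem measurable_untilt_toMeasure (v : C(E, ℝ≥0)) :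
    Measurable fun q => (untilt v q : Measure E) :=
  measurable_subtype_coe.comp (measurable_untilt v)

theorem setLIntegral_exp_untilt (v : C(E, ℝ≥0)) (q : ProbabilityMeasure E) {s : Set E}
    (hs : MeasurableSet s) :
    ∫⁻ y in s, ENNReal.ofReal (Real.exp (v y)) ∂(untilt v q : Measure E) =
      (q : Measure E) s * ENNReal.ofReal (∫ y, expNeg v y ∂(q : Measure E))⁻¹ := by
  rw [toMeasure_untilt, setLIntegral_tilted' _ _ hs, mul_comm, ← setLIntegral_const]
  refine lintegral_congr fun y => ?_
  change ENNReal.ofReal (Real.exp (-(v y : ℝ)) / ∫ y, expNeg v y ∂(q : Measure E)) * _ = _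
  rw [← ENNReal.ofReal_mul (div_nonneg (Real.exp_pos _).le (integral_expNeg_pos v q).le)]
  congr 1
  rw [div_mul_eq_mul_div, ← Real.exp_add]
  simp [expNeg_apply]

theorem measure_le_setLIntegral_exp_untilt (v : C(E, ℝ≥0)) (q : ProbabilityMeasure E) {s : Set E}
    (hs : MeasurableSet s) :
    (q : Measure E) s ≤ ∫⁻ y in s, ENNReal.ofReal (Real.exp (v y)) ∂(untilt v q : Measure E) := by
  rw [setLIntegral_exp_untilt v q hs]
  refine le_mul_of_one_le_right zero_le (ENNReal.one_le_ofReal.2 ?_)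
  exact (one_le_inv₀ (integral_expNeg_pos v q)).2 (integral_expNeg_le_one v q)

theorem integrable_exp_untilt (v : C(E, ℝ≥0)) (q : ProbabilityMeasure E) :
    Integrable (fun y => Real.exp (v y)) (untilt v q : Measure E) := by
  refine ⟨by fun_prop, ?_⟩
  rw [hasFiniteIntegral_iff_ofReal (Eventually.of_forall fun y => (Real.exp_pos _).le),
    ← setLIntegral_univ, setLIntegral_exp_untilt v q MeasurableSet.univ]
  simp

theorem exists_untilt_eq (v : C(E, ℝ≥0)) (p : ProbabilityMeasure E)
    (hp : Integrable (fun y => Real.exp (v y)) (p : Measure E)) : ∃ q, untilt v q = p := by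
  refine ⟨⟨(p : Measure E).tilted fun y => (v y : ℝ), isProbabilityMeasure_tilted hp⟩,
    Subtype.ext ?_⟩
  exact tilted_neg_same hp

/-- The pairing of `untilt v q` with the functions `h * exp v`, `h` bounded continuous. -/
def untiltPairing (v : C(E, ℝ≥0)) (q : ProbabilityMeasure E) : (E →ᵇ ℝ) →ₗ[ℝ] ℝ where
  toFun h := ∫ y, h y * Real.exp (v y) ∂(untilt v q : Measure E)
  map_add' f g := by
    have hi : ∀ f : E →ᵇ ℝ, Integrable (fun y => f y * Real.exp (v y)) (untilt v q : Measure E) :=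
      fun f => (integrable_exp_untilt v q).bdd_mul f.continuous.aestronglyMeasurable
        (Eventually.of_forall f.norm_coe_le_norm)
    simp only [BoundedContinuousFunction.coe_add, Pi.add_apply, add_mul]
    exact integral_add (hi f) (hi g)
  map_smul' c f := by
    simp only [BoundedContinuousFunction.coe_smul, smul_eq_mul, mul_assoc, RingHom.id_apply]
    exact integral_const_mul _ _

theorem untiltPairing_apply (v : C(E, ℝ≥0)) (q : ProbabilityMeasure E) (h : E →ᵇ ℝ) :
    untiltPairing v q h = ∫ y, h y * Real.exp (v y) ∂(untilt v q : Measure E) := rfl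

theorem untiltPairing_eq_div (v : C(E, ℝ≥0)) (q : ProbabilityMeasure E) (h : E →ᵇ ℝ) :
    untiltPairing v q h =
      (∫ y, h y ∂(q : Measure E)) / ∫ y, expNeg v y ∂(q : Measure E) := by
  rw [untiltPairing_apply, integral_untilt]
  congr 2 with y
  rw [mul_assoc, expNeg_apply, ← Real.exp_add]
  simp

theorem continuous_untiltPairing (v : C(E, ℝ≥0)) (h : E →ᵇ ℝ) :
    Continuous fun q => untiltPairing v q h := by
  simp only [untiltPairing_eq_div]
  exact (continuous_integral_bcf h).div (continuous_integral_bcf (expNeg v))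
    fun q => (integral_expNeg_pos v q).ne'

theorem tendsto_of_tendsto_untiltPairing (v : C(E, ℝ≥0)) {ι : Type*} {L : Filter ι}
    {q : ι → ProbabilityMeasure E} {q₀ : ProbabilityMeasure E}
    (H : ∀ h : E →ᵇ ℝ, Tendsto (fun i => untiltPairing v (q i) h) L (𝓝 (untiltPairing v q₀ h))) :
    Tendsto q L (𝓝 q₀) := by
  refine ProbabilityMeasure.tendsto_iff_forall_integral_tendsto.2 fun h => ?_
  have h1 : ∀ q : ProbabilityMeasure E, untiltPairing v q 1 ≠ 0 := fun q => by
    rw [untiltPairing_eq_div]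
    simpa using (integral_expNeg_pos v q).ne'
  have hq : ∀ q : ProbabilityMeasure E, ∫ y, h y ∂(q : Measure E) =
      untiltPairing v q h / untiltPairing v q 1 := fun q => by
    have := (integral_expNeg_pos v q).ne'
    rw [untiltPairing_eq_div, untiltPairing_eq_div]
    simp [div_mul_cancel₀ _ this]
  simp only [hq]
  exact (H h).div (H 1) (h1 _)

end Untilt

section Relaxed

open Topology Filter BoundedContinuousFunction

variable {E F : Type*} [TopologicalSpace E] [PolishSpace E] [MeasurableSpace E] [BorelSpace E]
  [TopologicalSpace F] [PolishSpace F] [MeasurableSpace F] [BorelSpace F]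

theorem measurable_untilt_snd (v : C(E, ℝ≥0)) :
    Measurable fun z : F × ProbabilityMeasure E => (untilt v z.2 : Measure E) :=
  (measurable_untilt_toMeasure v).comp measurable_snd

/-- The barycenter of the random measure `untilt v q`, for `(x, q)` distributed as `P`. -/
def intensity (v : C(E, ℝ≥0)) (P : ProbabilityMeasure (F × ProbabilityMeasure E)) :
    ProbabilityMeasure E :=
  ⟨(P : Measure (F × ProbabilityMeasure E)).bind fun z => (untilt v z.2 : Measure E), ⟨by
    rw [Measure.bind_apply MeasurableSet.univ (measurable_untilt_snd v).aemeasurable]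
    simp⟩⟩

theorem lintegral_intensity (v : C(E, ℝ≥0)) (P : ProbabilityMeasure (F × ProbabilityMeasure E))
    {f : E → ℝ≥0∞} (hf : Measurable f) :
    ∫⁻ y, f y ∂(intensity v P : Measure E) =
      ∫⁻ z, ∫⁻ y, f y ∂(untilt v z.2 : Measure E) ∂(P : Measure (F × ProbabilityMeasure E)) :=
  Measure.lintegral_bind (measurable_untilt_snd v).aemeasurable hf.aemeasurable

theorem continuous_intensity (v : C(E, ℝ≥0)) :
    Continuous (intensity (F := F) v) := by
  refine continuous_iff_continuousAt.2 fun P =>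
    ProbabilityMeasure.tendsto_iff_forall_lintegral_tendsto.2 fun f => ?_
  let g : F × ProbabilityMeasure E →ᵇ ℝ≥0 :=
    BoundedContinuousFunction.mkOfBound
      ⟨fun z => (untilt v z.2).toFiniteMeasure.testAgainstNN f,
        (FiniteMeasure.continuous_testAgainstNN_eval f).comp
          (ProbabilityMeasure.toFiniteMeasure_continuous.comp
            ((continuous_untilt v).comp continuous_snd))⟩ (2 * nndist f 0) (by
      intro z z'
      have hb : ∀ z : F × ProbabilityMeasure E,
          (untilt v z.2).toFiniteMeasure.testAgainstNN f ≤ nndist f 0 := fun z => by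
        simpa using FiniteMeasure.testAgainstNN_lipschitz_estimate
          (untilt v z.2).toFiniteMeasure f 0
      refine (dist_triangle_right _ _ (0 : ℝ≥0)).trans ?_
      simp only [ContinuousMap.coe_mk, NNReal.dist_eq, NNReal.coe_zero, sub_zero, NNReal.abs_eq]
      have h1 := hb z
      have h2 := hb z'
      rw [← NNReal.coe_le_coe] at h1 h2
      linarith [coe_nndist f 0])
  have hg : ∀ P : ProbabilityMeasure (F × ProbabilityMeasure E),
      ∫⁻ y, f y ∂(intensity v P : Measure E) = ∫⁻ z, g z ∂(P : Measure _) := fun P => by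
    rw [lintegral_intensity v P (by fun_prop)]
    exact lintegral_congr fun z =>
      (FiniteMeasure.testAgainstNN_coe_eq (μ := (untilt v z.2).toFiniteMeasure) (f := f)).symm
  simp only [hg]
  exact ProbabilityMeasure.tendsto_iff_forall_lintegral_tendsto.1 tendsto_id g

/-- The relaxed weak transport value, where `x ↦ π_x` is replaced by a random measure. -/
def relaxedValue (v : C(E, ℝ≥0)) (D : F × ProbabilityMeasure E → ℝ≥0∞)
    (m : ProbabilityMeasure F) (n : ProbabilityMeasure E) : ℝ≥0∞ :=
  ⨅ P : {P : ProbabilityMeasure (F × ProbabilityMeasure E) //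
      (P : Measure (F × ProbabilityMeasure E)).map Prod.fst = m ∧ intensity v P = n},
    ∫⁻ z, D z ∂(P.1 : Measure (F × ProbabilityMeasure E))

theorem lowerSemicontinuous_relaxedValue (v : C(E, ℝ≥0)) {D : F × ProbabilityMeasure E → ℝ≥0∞}
    (hD : LowerSemicontinuous D) :
    LowerSemicontinuous fun z : ProbabilityMeasure F × ProbabilityMeasure E =>
      relaxedValue v D z.1 (untilt v z.2) := by
  let := TopologicalSpace.upgradeIsCompletelyMetrizable F
  let := TopologicalSpace.upgradeIsCompletelyMetrizable E
  let := TopologicalSpace.metrizableSpaceMetric (F × ProbabilityMeasure E)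
  rw [lowerSemicontinuous_iff_isClosed_preimage]
  intro c
  refine IsSeqClosed.isClosed fun z z₀ hz hz₀ => ?_
  simp only [Set.mem_preimage, Set.mem_Iic] at hz ⊢
  rcases eq_or_ne c ⊤ with rfl | hc
  · exact le_top
  have hz1 : Tendsto (fun n => (z n).1) atTop (𝓝 z₀.1) := (continuous_fst.tendsto _).comp hz₀
  have hz2 : Tendsto (fun n => (z n).2) atTop (𝓝 z₀.2) := (continuous_snd.tendsto _).comp hz₀
  have hlt : ∀ n : ℕ, relaxedValue v D (z n).1 (untilt v (z n).2) < c + (n + 1 : ℝ≥0∞)⁻¹ :=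
    fun n => (hz n).trans_lt (ENNReal.lt_add_right hc (by simp))
  choose P hP using fun n => iInf_lt_iff.1 (hlt n)
  have hmarg : ∀ ε : ℝ≥0∞, 0 < ε → ∃ K : Set F, IsCompact K ∧
      ∀ n, ((P n).1 : Measure (F × ProbabilityMeasure E)).map Prod.fst Kᶜ ≤ ε := fun ε hε => by
    obtain ⟨K, hK, h⟩ := exists_isCompact_compl_le_of_tendsto hz1 hε
    exact ⟨K, hK, fun n => by rw [(P n).2.1]; exact h n⟩
  have hint : ∀ ε : ℝ≥0∞, 0 < ε → ∃ K : Set E, IsCompact K ∧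
      ∀ n, ∫⁻ z, (z.2 : Measure E) Kᶜ ∂((P n).1 : Measure (F × ProbabilityMeasure E)) ≤ ε := by
    intro ε hε
    have hinv : Tendsto (fun n => (∫ y, expNeg v y ∂((z n).2 : Measure E))⁻¹) atTop
        (𝓝 (∫ y, expNeg v y ∂(z₀.2 : Measure E))⁻¹) :=
      (((continuous_integral_bcf (expNeg v)).tendsto _).comp hz2).inv₀
        (integral_expNeg_pos v _).ne'
    obtain ⟨M, hM⟩ := hinv.bddAbove_range
    have hMn : ∀ n, ENNReal.ofReal (∫ y, expNeg v y ∂((z n).2 : Measure E))⁻¹ ≤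
        ENNReal.ofReal M := fun n => ENNReal.ofReal_le_ofReal (hM ⟨n, rfl⟩)
    obtain ⟨K, hK, h⟩ := exists_isCompact_compl_le_of_tendsto hz2
      (ε := ε / ENNReal.ofReal M) (ENNReal.div_pos hε.ne' ofReal_ne_top)
    refine ⟨K, hK, fun n => ?_⟩
    have hKm := hK.measurableSet.compl
    calc ∫⁻ z, (z.2 : Measure E) Kᶜ ∂((P n).1 : Measure (F × ProbabilityMeasure E))
        ≤ ∫⁻ z, ∫⁻ y in Kᶜ, ENNReal.ofReal (Real.exp (v y)) ∂(untilt v z.2 : Measure E)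
            ∂((P n).1 : Measure (F × ProbabilityMeasure E)) :=
          lintegral_mono fun z => measure_le_setLIntegral_exp_untilt v z.2 hKm
      _ = ∫⁻ y in Kᶜ, ENNReal.ofReal (Real.exp (v y)) ∂(untilt v (z n).2 : Measure E) := by
          have h := lintegral_intensity v (P n).1
            (f := Kᶜ.indicator fun y => ENNReal.ofReal (Real.exp (v y)))
            ((by fun_prop : Measurable _).indicator hKm)
          simp only [lintegral_indicator hKm, (P n).2.2] at h
          exact h.symm
      _ = ((z n).2 : Measure E) Kᶜ *
            ENNReal.ofReal (∫ y, expNeg v y ∂((z n).2 : Measure E))⁻¹ :=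
          setLIntegral_exp_untilt v _ hKm
      _ ≤ ε / ENNReal.ofReal M * ENNReal.ofReal M := mul_le_mul' (h n) (hMn n)
      _ ≤ ε := by rw [mul_comm]; exact ENNReal.mul_div_le
  obtain ⟨Q, φ, hφ, hQ⟩ := exists_subseq_tendsto_of_intensity (fun n => (P n).1) hmarg hint
  have hQ1 : (Q : Measure (F × ProbabilityMeasure E)).map Prod.fst = z₀.1 := by
    have h1 := ((ProbabilityMeasure.continuous_map
      (continuous_fst (X := F) (Y := ProbabilityMeasure E))).tendsto Q).comp hQ
    have h2 := tendsto_nhds_unique (h1.congr fun n =>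
      show _ = (z (φ n)).1 from Subtype.ext (P (φ n)).2.1) (hz1.comp hφ.tendsto_atTop)
    exact congrArg (fun q : ProbabilityMeasure F => (q : Measure F)) h2
  have hQ2 : intensity v Q = untilt v z₀.2 := by
    have h1 := ((continuous_intensity v).tendsto Q).comp hQ
    exact tendsto_nhds_unique (h1.congr fun n => (P (φ n)).2.2)
      (((continuous_untilt v).tendsto _).comp (hz2.comp hφ.tendsto_atTop))
  calc relaxedValue v D z₀.1 (untilt v z₀.2)
      ≤ ∫⁻ z, D z ∂(Q : Measure (F × ProbabilityMeasure E)) := iInf_le_of_le ⟨Q, hQ1, hQ2⟩ le_rfl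
    _ ≤ liminf (fun n => ∫⁻ z, D z ∂((P (φ n)).1 : Measure (F × ProbabilityMeasure E))) atTop :=
        lintegral_le_liminf_lintegral_of_lowerSemicontinuous hD hQ
    _ ≤ liminf (fun n => c + ((φ n : ℕ) + 1 : ℝ≥0∞)⁻¹) atTop :=
        liminf_le_liminf (Eventually.of_forall fun n => (hP (φ n)).le)
    _ = c := by
        refine Tendsto.liminf_eq ?_
        have : Tendsto (fun n : ℕ => c + ((n : ℝ≥0∞) + 1)⁻¹) atTop (𝓝 (c + 0)) := by
          refine tendsto_const_nhds.add ?_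
          have h := (tendsto_add_atTop_iff_nat 1).2 ENNReal.tendsto_inv_nat_nhds_zero
          simpa using h
        rw [add_zero] at this
        exact this.comp hφ.tendsto_atTop

end Relaxed

theorem MeasureTheory.ofReal_integral_le_lintegral_ofReal {Ω : Type*} [MeasurableSpace Ω]
    {m : Measure Ω} (f : Ω → ℝ) :
    ENNReal.ofReal (∫ x, f x ∂m) ≤ ∫⁻ x, ENNReal.ofReal (f x) ∂m := by
  by_cases hf : Integrable f m
  · calc ENNReal.ofReal (∫ x, f x ∂m)
        ≤ ENNReal.ofReal (∫ x, max (f x) 0 ∂m) := ENNReal.ofReal_le_ofReal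
          (integral_mono hf hf.pos_part fun x => le_max_left _ _)
      _ = ∫⁻ x, ENNReal.ofReal (max (f x) 0) ∂m :=
          ofReal_integral_eq_lintegral_ofReal hf.pos_part
            (Filter.Eventually.of_forall fun x => le_max_right _ _)
      _ = ∫⁻ x, ENNReal.ofReal (f x) ∂m := by simp [ENNReal.ofReal_max]
  · simp [integral_undef hf]

section Minorants

open Topology Filter BoundedContinuousFunction

/-- The convex combination of two probability measures. -/
def mixture {Ω : Type*} [MeasurableSpace Ω] (a b : ℝ≥0) (hab : a + b = 1)
    (p q : ProbabilityMeasure Ω) : ProbabilityMeasure Ω :=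
  ⟨(a : ℝ≥0∞) • (p : Measure Ω) + (b : ℝ≥0∞) • (q : Measure Ω), ⟨by
    simp [← ENNReal.coe_add, hab]⟩⟩

theorem toMeasure_mixture {Ω : Type*} [MeasurableSpace Ω] (a b : ℝ≥0) (hab : a + b = 1)
    (p q : ProbabilityMeasure Ω) : (mixture a b hab p q : Measure Ω) =
      (a : ℝ≥0∞) • (p : Measure Ω) + (b : ℝ≥0∞) • (q : Measure Ω) := rfl

theorem integrable_mixture {Ω : Type*} [MeasurableSpace Ω] (a b : ℝ≥0) (hab : a + b = 1)
    {p q : ProbabilityMeasure Ω} {f : Ω → ℝ} (hp : Integrable f (p : Measure Ω))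
    (hq : Integrable f (q : Measure Ω)) : Integrable f (mixture a b hab p q : Measure Ω) := by
  rw [toMeasure_mixture]
  exact (hp.smul_measure coe_ne_top).add_measure (hq.smul_measure coe_ne_top)

theorem integral_mixture {Ω : Type*} [MeasurableSpace Ω] (a b : ℝ≥0) (hab : a + b = 1)
    {p q : ProbabilityMeasure Ω} {f : Ω → ℝ} (hp : Integrable f (p : Measure Ω))
    (hq : Integrable f (q : Measure Ω)) : ∫ x, f x ∂(mixture a b hab p q : Measure Ω) =
      a * ∫ x, f x ∂(p : Measure Ω) + b * ∫ x, f x ∂(q : Measure Ω) := by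
  rw [toMeasure_mixture, integral_add_measure (hp.smul_measure coe_ne_top)
    (hq.smul_measure coe_ne_top), integral_smul_measure, integral_smul_measure]
  simp

theorem lintegral_mixture {Ω : Type*} [MeasurableSpace Ω] (a b : ℝ≥0) (hab : a + b = 1)
    (p q : ProbabilityMeasure Ω) (f : Ω → ℝ≥0∞) : ∫⁻ x, f x ∂(mixture a b hab p q : Measure Ω) =
      a * ∫⁻ x, f x ∂(p : Measure Ω) + b * ∫⁻ x, f x ∂(q : Measure Ω) := by
  rw [toMeasure_mixture, lintegral_add_measure, lintegral_smul_measure, lintegral_smul_measure]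
  simp

variable {E F : Type*} [TopologicalSpace E] [PolishSpace E] [MeasurableSpace E] [BorelSpace E]
  [TopologicalSpace F] [PolishSpace F] [MeasurableSpace F] [BorelSpace F]

theorem exists_untilt_eq_mixture (v : C(E, ℝ≥0)) (a b : ℝ≥0) (hab : a + b = 1)
    (r₁ r₂ : ProbabilityMeasure E) :
    ∃ r, untilt v r = mixture a b hab (untilt v r₁) (untilt v r₂) :=
  exists_untilt_eq v _ (integrable_mixture a b hab (integrable_exp_untilt v r₁)
    (integrable_exp_untilt v r₂))

theorem integrable_mul_exp_untilt (v : C(E, ℝ≥0)) (r : ProbabilityMeasure E) (h : E →ᵇ ℝ) :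
    Integrable (fun y => h y * Real.exp (v y)) (untilt v r : Measure E) :=
  (integrable_exp_untilt v r).bdd_mul h.continuous.aestronglyMeasurable
    (Eventually.of_forall h.norm_coe_le_norm)

theorem untiltPairing_of_eq_mixture (v : C(E, ℝ≥0)) {a b : ℝ≥0} {hab : a + b = 1}
    {r₁ r₂ r : ProbabilityMeasure E}
    (hr : untilt v r = mixture a b hab (untilt v r₁) (untilt v r₂)) :
    untiltPairing v r = (a : ℝ) • untiltPairing v r₁ + (b : ℝ) • untiltPairing v r₂ := by
  ext h
  simp only [untiltPairing_apply, LinearMap.add_apply, LinearMap.smul_apply, smul_eq_mul]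
  rw [hr, integral_mixture a b hab (integrable_mul_exp_untilt v r₁ h)
    (integrable_mul_exp_untilt v r₂ h)]

theorem isInducing_untiltPairing (v : C(E, ℝ≥0)) :
    IsInducing fun (r : ProbabilityMeasure E) (h : E →ᵇ ℝ) => untiltPairing v r h := by
  refine isInducing_iff_nhds.2 fun r => le_antisymm ?_ ?_
  · exact ((continuous_pi fun h => continuous_untiltPairing v h).tendsto r).le_comap
  · exact tendsto_id'.1 (tendsto_of_tendsto_untiltPairing v fun h =>
      ((continuous_apply h).tendsto _).comp tendsto_comap)

/-- Jensen's inequality for convex lower semicontinuous functions on reweighted measures. -/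
theorem le_lintegral_of_bind_untilt (v : C(E, ℝ≥0)) {W : ProbabilityMeasure E → ℝ≥0∞}
    (hW : LowerSemicontinuous W)
    (hconv : ∀ (r₁ r₂ r : ProbabilityMeasure E) (a b : ℝ≥0) (hab : a + b = 1),
      untilt v r = mixture a b hab (untilt v r₁) (untilt v r₂) → W r ≤ a * W r₁ + b * W r₂)
    {ρ : Measure (ProbabilityMeasure E)} [IsProbabilityMeasure ρ] {r₀ : ProbabilityMeasure E}
    (hr₀ : (untilt v r₀ : Measure E) = ρ.bind fun r => (untilt v r : Measure E)) :
    W r₀ ≤ ∫⁻ r, W r ∂ρ := by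
  refine le_of_forall_lt fun c hc => ?_
  have hc_top : c ≠ ⊤ := hc.ne_top
  obtain ⟨h, α, hle, hlt⟩ := exists_affine_minorant (untiltPairing v) (isInducing_untiltPairing v)
    W hW (fun r₁ r₂ a b hab => by
      obtain ⟨r, hr⟩ := exists_untilt_eq_mixture v a b hab r₁ r₂
      exact ⟨r, untiltPairing_of_eq_mixture v hr, hconv r₁ r₂ r a b hab hr⟩) r₀ c.toReal
    (by rwa [ENNReal.ofReal_toReal hc_top])
  let κ : Kernel (ProbabilityMeasure E) E :=
    ⟨fun r => (untilt v r : Measure E), measurable_untilt_toMeasure v⟩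
  have hκ : (untilt v r₀ : Measure E) = (κ ∘ₖ Kernel.const Unit ρ) () := by
    rw [← Measure.comp_eq_comp_const_apply]
    exact hr₀
  have hint := integrable_mul_exp_untilt v r₀ h
  have h1 : untiltPairing v r₀ h = ∫ r, untiltPairing v r h ∂ρ := by
    rw [untiltPairing_apply]
    rw [hκ] at hint ⊢
    exact Kernel.integral_comp hint
  have h2 : Integrable (fun r => untiltPairing v r h) ρ := by
    rw [hκ] at hint
    exact hint.integral_comp
  have h3 : untiltPairing v r₀ h + α = ∫ r, (untiltPairing v r h + α) ∂ρ := by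
    rw [integral_add h2 (integrable_const _), h1]
    simp
  calc c = ENNReal.ofReal c.toReal := (ENNReal.ofReal_toReal hc_top).symm
    _ < ENNReal.ofReal (untiltPairing v r₀ h + α) :=
        (ENNReal.ofReal_lt_ofReal_iff_of_nonneg toReal_nonneg).2 hlt
    _ ≤ ∫⁻ r, ENNReal.ofReal (untiltPairing v r h + α) ∂ρ := by
        rw [h3]
        exact ofReal_integral_le_lintegral_ofReal _
    _ ≤ ∫⁻ r, W r ∂ρ := lintegral_mono hle

theorem intensity_mixture (v : C(E, ℝ≥0)) (a b : ℝ≥0) (hab : a + b = 1)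
    (P₁ P₂ : ProbabilityMeasure (F × ProbabilityMeasure E)) :
    intensity v (mixture a b hab P₁ P₂) = mixture a b hab (intensity v P₁) (intensity v P₂) := by
  refine Subtype.ext (Measure.ext_of_lintegral _ fun f hf => ?_)
  refine (lintegral_intensity v _ hf).trans ?_
  refine (lintegral_mixture a b hab _ _ _).trans ?_
  rw [← lintegral_intensity v _ hf, ← lintegral_intensity v _ hf]
  exact (lintegral_mixture a b hab _ _ _).symm

theorem relaxedValue_mixture_le (v : C(E, ℝ≥0)) (D : F × ProbabilityMeasure E → ℝ≥0∞)
    {a b : ℝ≥0} (ha : a ≠ 0) (hb : b ≠ 0) (hab : a + b = 1) (m₁ m₂ : ProbabilityMeasure F)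
    (n₁ n₂ : ProbabilityMeasure E) :
    relaxedValue v D (mixture a b hab m₁ m₂) (mixture a b hab n₁ n₂) ≤
      a * relaxedValue v D m₁ n₁ + b * relaxedValue v D m₂ n₂ := by
  simp only [relaxedValue]
  rw [ENNReal.mul_iInf_of_ne (by simpa using ha) coe_ne_top,
    ENNReal.mul_iInf_of_ne (by simpa using hb) coe_ne_top, ENNReal.iInf_add]
  simp only [ENNReal.add_iInf]
  refine le_iInf₂ fun P₁ P₂ => iInf_le_of_le ⟨mixture a b hab P₁.1 P₂.1, ?_, ?_⟩ ?_
  · rw [toMeasure_mixture, Measure.map_add _ _ measurable_fst, Measure.map_smul,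
      Measure.map_smul, P₁.2.1, P₂.2.1]
    rfl
  · rw [intensity_mixture, P₁.2.2, P₂.2.2]
  · exact (lintegral_mixture a b hab _ _ _).le

/-- The pairing of a pair `(m, untilt v r)` of measures with a pair of functions. -/
def pairing (v : C(E, ℝ≥0)) (z : ProbabilityMeasure F × ProbabilityMeasure E) :
    ((F →ᵇ ℝ) × (E →ᵇ ℝ)) →ₗ[ℝ] ℝ :=
  LinearMap.coprod
    { toFun := fun f => ∫ x, f x ∂(z.1 : Measure F)
      map_add' := fun f g => integral_add (integrable_bcf z.1 f) (integrable_bcf z.1 g)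
      map_smul' := fun c f => integral_const_mul c f }
    (untiltPairing v z.2)

theorem pairing_apply (v : C(E, ℝ≥0)) (z : ProbabilityMeasure F × ProbabilityMeasure E)
    (f : (F →ᵇ ℝ) × (E →ᵇ ℝ)) :
    pairing v z f = ∫ x, f.1 x ∂(z.1 : Measure F) + untiltPairing v z.2 f.2 := rfl

theorem isInducing_pairing (v : C(E, ℝ≥0)) :
    IsInducing fun (z : ProbabilityMeasure F × ProbabilityMeasure E)
      (f : (F →ᵇ ℝ) × (E →ᵇ ℝ)) => pairing v z f := by
  refine isInducing_iff_nhds.2 fun z => le_antisymm ?_ ?_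
  · have : Continuous fun (z : ProbabilityMeasure F × ProbabilityMeasure E)
        (f : (F →ᵇ ℝ) × (E →ᵇ ℝ)) => pairing v z f :=
      continuous_pi fun f => ((continuous_integral_bcf f.1).comp continuous_fst).add
        ((continuous_untiltPairing v f.2).comp continuous_snd)
    exact (this.tendsto z).le_comap
  · have H : ∀ f : (F →ᵇ ℝ) × (E →ᵇ ℝ), Tendsto (fun z => pairing v z f)
        (comap (fun z f => pairing v z f) (𝓝 fun f => pairing v z f)) (𝓝 (pairing v z f)) :=
      fun f => ((continuous_apply f).tendsto _).comp tendsto_comap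
    refine tendsto_id'.1 (Tendsto.prodMk_nhds (x := z.1) (y := z.2) ?_ ?_)
    · refine ProbabilityMeasure.tendsto_iff_forall_integral_tendsto.2 fun f => ?_
      simpa [pairing_apply] using H (f, 0)
    · refine tendsto_of_tendsto_untiltPairing v fun h => ?_
      simpa [pairing_apply] using H (0, h)

theorem exists_pairing_minorant (v : C(E, ℝ≥0)) {D : F × ProbabilityMeasure E → ℝ≥0∞}
    (hD : LowerSemicontinuous D) (m : ProbabilityMeasure F) (r : ProbabilityMeasure E) (α : ℝ)
    (hα : ENNReal.ofReal α < relaxedValue v D m (untilt v r)) :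
    ∃ (f : F →ᵇ ℝ) (h : E →ᵇ ℝ),
      (∀ x q, ENNReal.ofReal (f x + untiltPairing v q h) ≤ D (x, q)) ∧
      α < ∫ x, f x ∂(m : Measure F) + untiltPairing v r h := by
  obtain ⟨f, a, hle, hlt⟩ := exists_affine_minorant (pairing (F := F) v) (isInducing_pairing v)
    (fun z => relaxedValue v D z.1 (untilt v z.2)) (lowerSemicontinuous_relaxedValue v hD)
    (fun z₁ z₂ a b hab => by
      rcases eq_or_ne a 0 with rfl | ha
      · obtain rfl : b = 1 := by simpa using hab
        exact ⟨z₂, by simp, by simp⟩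
      rcases eq_or_ne b 0 with rfl | hb
      · obtain rfl : a = 1 := by simpa using hab
        exact ⟨z₁, by simp, by simp⟩
      obtain ⟨r, hr⟩ := exists_untilt_eq_mixture v a b hab z₁.2 z₂.2
      refine ⟨(mixture a b hab z₁.1 z₂.1, r), ?_, ?_⟩
      · refine LinearMap.ext fun f => ?_
        simp only [pairing_apply, LinearMap.add_apply, LinearMap.smul_apply, smul_eq_mul]
        rw [untiltPairing_of_eq_mixture v hr, integral_mixture a b hab (integrable_bcf _ _)
          (integrable_bcf _ _)]
        simp only [LinearMap.add_apply, LinearMap.smul_apply, smul_eq_mul]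
        ring
      · simp only [hr]
        exact relaxedValue_mixture_le v D ha hb hab _ _ _ _) (m, r) α hα
  refine ⟨f.1 + BoundedContinuousFunction.const F a, f.2, fun x q => ?_, ?_⟩
  · let P : ProbabilityMeasure (F × ProbabilityMeasure E) := ⟨Measure.dirac (x, q), inferInstance⟩
    let δ : ProbabilityMeasure F := ⟨Measure.dirac x, inferInstance⟩
    have h1 : relaxedValue v D δ (untilt v q) ≤ D (x, q) := by
      refine iInf_le_of_le ⟨P, ?_, ?_⟩ (lintegral_dirac' (x, q) hD.measurable).le
      · exact Measure.map_dirac' measurable_fst _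
      · refine Subtype.ext (Measure.ext_of_lintegral _ fun f hf => ?_)
        refine (lintegral_intensity v P hf).trans (lintegral_dirac' _ ?_)
        exact (Measure.measurable_lintegral hf).comp (measurable_untilt_snd v)
    refine le_trans (le_of_eq ?_) ((hle (δ, q)).trans h1)
    congr 1
    have : ∫ x, f.1 x ∂(δ : Measure F) = f.1 x :=
      integral_dirac' _ _ f.1.continuous.stronglyMeasurable
    rw [pairing_apply, this]
    simp
    ring
  · rw [pairing_apply] at hlt
    have : ∫ x, (f.1 + BoundedContinuousFunction.const F a) x ∂(m : Measure F) =
        ∫ x, f.1 x ∂(m : Measure F) + a := by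
      simp only [BoundedContinuousFunction.coe_add, Pi.add_apply,
        BoundedContinuousFunction.const_apply]
      rw [integral_add (integrable_bcf m f.1) (integrable_const _)]
      simp
    rw [this]
    linarith

end Minorants

section Recovery

variable {E F : Type*} [TopologicalSpace E] [PolishSpace E] [MeasurableSpace E] [BorelSpace E]
  [TopologicalSpace F] [PolishSpace F] [MeasurableSpace F] [BorelSpace F] [Nonempty E]

/-- The kernel `q ↦ untilt v q`. -/
def untiltKernel (v : C(E, ℝ≥0)) : Kernel (ProbabilityMeasure E) E :=
  ⟨fun r => (untilt v r : Measure E), measurable_untilt_toMeasure v⟩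

instance (v : C(E, ℝ≥0)) : IsMarkovKernel (untiltKernel v) :=
  ⟨fun r => (inferInstance : IsProbabilityMeasure (untilt v r : Measure E))⟩

theorem exists_coupling_lintegral_le (v : C(E, ℝ≥0)) {W : F → ProbabilityMeasure E → ℝ≥0∞}
    (hW : LowerSemicontinuous fun z : F × ProbabilityMeasure E => W z.1 (untilt v z.2))
    (hconv : ∀ (x : F) (r₁ r₂ r : ProbabilityMeasure E) (a b : ℝ≥0) (hab : a + b = 1),
      untilt v r = mixture a b hab (untilt v r₁) (untilt v r₂) →
        W x (untilt v r) ≤ a * W x (untilt v r₁) + b * W x (untilt v r₂))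
    (P : ProbabilityMeasure (F × ProbabilityMeasure E))
    (hP : Integrable (fun y => Real.exp (v y)) (intensity v P : Measure E)) :
    ∃ π : ProbabilityMeasure (F × E),
      (π : Measure (F × E)).map Prod.fst = (P : Measure (F × ProbabilityMeasure E)).map Prod.fst ∧
      (π : Measure (F × E)).map Prod.snd = intensity v P ∧
      ∫⁻ x, W x ⟨(π : Measure (F × E)).condKernel x, inferInstance⟩
          ∂(P : Measure (F × ProbabilityMeasure E)).map Prod.fst ≤
        ∫⁻ z, W z.1 (untilt v z.2) ∂(P : Measure (F × ProbabilityMeasure E)) := by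
  have : Nonempty (ProbabilityMeasure E) :=
    ⟨⟨Measure.dirac (Classical.arbitrary E), inferInstance⟩⟩
  set m := (P : Measure (F × ProbabilityMeasure E)).fst with hm
  set κ := (P : Measure (F × ProbabilityMeasure E)).condKernel with hκ
  have hPκ : m ⊗ₘ κ = P := Measure.disintegrate _ _
  let η : Kernel F E := untiltKernel v ∘ₖ κ
  let π : ProbabilityMeasure (F × E) := ⟨m ⊗ₘ η, inferInstance⟩
  have hπ : (π : Measure (F × E)) = m ⊗ₘ η := rfl
  have hfst : (π : Measure (F × E)).fst = m := by rw [hπ, Measure.fst_compProd]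
  have hη : ∀ᵐ x ∂m, η x = (π : Measure (F × E)).condKernel x := by
    have h := eq_condKernel_of_measure_eq_compProd (ρ := (π : Measure (F × E))) η
      (by rw [hfst, hπ])
    rwa [hfst] at h
  have hlint : ∀ {f : E → ℝ≥0∞}, Measurable f →
      ∫⁻ y, f y ∂(intensity v P : Measure E) = ∫⁻ x, ∫⁻ y, f y ∂(η x) ∂m := fun {f} hf => by
    have hmeas : Measurable fun z : F × ProbabilityMeasure E =>
        ∫⁻ y, f y ∂(untilt v z.2 : Measure E) :=
      (Measure.measurable_lintegral hf).comp (measurable_untilt_snd v)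
    rw [lintegral_intensity v P hf, ← hPκ, Measure.lintegral_compProd hmeas]
    refine lintegral_congr fun x => ?_
    rw [Kernel.lintegral_comp _ _ _ hf]
    rfl
  refine ⟨π, hfst, Measure.ext_of_lintegral _ fun f hf => ?_, ?_⟩
  · rw [lintegral_map hf measurable_snd, hπ, hlint hf]
    exact Measure.lintegral_compProd (f := fun z : F × E => f z.2) (hf.comp measurable_snd)
  have hexp : Measurable fun y => ENNReal.ofReal (Real.exp (v y)) := by fun_prop
  have hfin : ∀ᵐ x ∂m, ∫⁻ y, ENNReal.ofReal (Real.exp (v y)) ∂(η x) < ⊤ := by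
    refine ae_lt_top hexp.lintegral_kernel ?_
    rw [← hlint hexp]
    exact hP.lintegral_lt_top.ne
  have hcost : ∫⁻ z, W z.1 (untilt v z.2) ∂(P : Measure (F × ProbabilityMeasure E)) =
      ∫⁻ x, ∫⁻ r, W x (untilt v r) ∂(κ x) ∂m := by
    rw [← hPκ, Measure.lintegral_compProd hW.measurable]
  rw [hcost]
  refine lintegral_mono_ae (μ := m) ?_
  filter_upwards [hη, hfin] with x hx hxfin
  let p : ProbabilityMeasure E := ⟨η x, inferInstance⟩
  have hint : Integrable (fun y => Real.exp (v y)) (p : Measure E) := by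
    refine ⟨by fun_prop, ?_⟩
    rw [hasFiniteIntegral_iff_ofReal (Filter.Eventually.of_forall fun y => (Real.exp_pos _).le)]
    exact hxfin
  obtain ⟨r₀, hr₀⟩ := exists_untilt_eq v p hint
  have heq : (⟨(π : Measure (F × E)).condKernel x, inferInstance⟩ : ProbabilityMeasure E) =
      untilt v r₀ := by
    rw [hr₀]
    exact Subtype.ext hx.symm
  rw [heq]
  refine le_lintegral_of_bind_untilt v (W := fun r => W x (untilt v r))
    (hW.comp (Continuous.prodMk_right x)) (hconv x) ?_
  rw [hr₀]
  exact Kernel.comp_apply _ _ _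

end Recovery

section MomentWeight

open BoundedContinuousFunction

variable {E : Type*} [MetricSpace E] {t : ℝ}

/-- The weight `log (1 + d(y, y₀)^t)`. -/
def momentWeight (ht : 0 ≤ t) (y₀ : E) : C(E, ℝ≥0) where
  toFun y := ⟨Real.log (1 + dist y y₀ ^ t),
    Real.log_nonneg (le_add_of_nonneg_right (Real.rpow_nonneg dist_nonneg t))⟩
  continuous_toFun := by
    refine Continuous.subtype_mk (Continuous.log (continuous_const.add
      ((continuous_id.dist continuous_const).rpow_const fun _ => Or.inr ht)) fun y => ?_) _
    have := Real.rpow_nonneg (dist_nonneg (x := y) (y := y₀)) t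
    exact (by positivity : (0 : ℝ) < 1 + dist y y₀ ^ t).ne'

theorem exp_momentWeight (ht : 0 ≤ t) (y₀ y : E) :
    Real.exp (momentWeight ht y₀ y) = 1 + dist y y₀ ^ t := by
  refine Real.exp_log ?_
  have := Real.rpow_nonneg (dist_nonneg (x := y) (y := y₀)) t
  positivity

theorem one_add_dist_rpow_le (ht : 0 ≤ t) (y z w : E) :
    1 + dist y z ^ t ≤ 2 ^ t * (1 + dist w z ^ t) * (1 + dist y w ^ t) := by
  have hA := Real.rpow_nonneg (dist_nonneg (x := y) (y := w)) t
  have hB := Real.rpow_nonneg (dist_nonneg (x := w) (y := z)) t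
  have h2 : (1 : ℝ) ≤ 2 ^ t := Real.one_le_rpow one_le_two ht
  have h : dist y z ^ t ≤ 2 ^ t * (dist y w ^ t + dist w z ^ t) := by
    rcases le_total (dist y w) (dist w z) with hle | hle
    · calc dist y z ^ t ≤ (2 * dist w z) ^ t := Real.rpow_le_rpow dist_nonneg
            (by linarith [dist_triangle y w z]) ht
        _ = 2 ^ t * dist w z ^ t := Real.mul_rpow zero_le_two dist_nonneg
        _ ≤ _ := by gcongr; linarith
    · calc dist y z ^ t ≤ (2 * dist y w) ^ t := Real.rpow_le_rpow dist_nonneg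
            (by linarith [dist_triangle y w z]) ht
        _ = 2 ^ t * dist y w ^ t := Real.mul_rpow zero_le_two dist_nonneg
        _ ≤ _ := by gcongr; linarith
  nlinarith [mul_nonneg hA hB]

theorem exists_abs_le_exp_momentWeight (ht : 0 ≤ t) (y₀ : E) {g : E → ℝ} (hg : g ∈ PhiT t E) :
    ∃ K, ∀ y, |g y| ≤ K * Real.exp (momentWeight ht y₀ y) := by
  obtain ⟨-, K, z, hK⟩ := hg
  have hK0 : 0 ≤ K := by
    refine nonneg_of_mul_nonneg_left ((abs_nonneg _).trans (hK y₀)) ?_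
    have := Real.rpow_nonneg (dist_nonneg (x := y₀) (y := z)) t
    positivity
  refine ⟨K * (2 ^ t * (1 + dist y₀ z ^ t)), fun y => (hK y).trans ?_⟩
  rw [exp_momentWeight, mul_assoc]
  exact mul_le_mul_of_nonneg_left (one_add_dist_rpow_le ht y z y₀) hK0

variable [PolishSpace E] [MeasurableSpace E] [BorelSpace E]

theorem memPt_iff_integrable (ht : 0 ≤ t) (y₀ : E) (p : ProbabilityMeasure E) :
    MemPt t p ↔ Integrable (fun y => Real.exp (momentWeight ht y₀ y)) (p : Measure E) := by
  have hcont : Continuous fun y : E => 1 + dist y y₀ ^ t :=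
    continuous_const.add ((continuous_id.dist continuous_const).rpow_const fun _ => Or.inr ht)
  simp only [exp_momentWeight]
  constructor
  · rintro ⟨z, hz⟩
    have h : Integrable (fun y => 2 ^ t * (1 + dist z y₀ ^ t) * (1 + dist y z ^ t))
        (p : Measure E) := ((integrable_const 1).add hz).const_mul _
    refine h.mono' hcont.aestronglyMeasurable (Filter.Eventually.of_forall fun y => ?_)
    have := Real.rpow_nonneg (dist_nonneg (x := y) (y := y₀)) t
    rw [Real.norm_of_nonneg (by positivity)]
    exact one_add_dist_rpow_le ht y y₀ z
  · intro h
    refine ⟨y₀, ?_⟩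
    exact (h.sub (integrable_const (1 : ℝ))).congr (Filter.Eventually.of_forall fun y => by simp)

theorem memPt_untilt (ht : 0 ≤ t) (y₀ : E) (r : ProbabilityMeasure E) :
    MemPt t (untilt (momentWeight ht y₀) r) :=
  (memPt_iff_integrable ht y₀ _).2 (integrable_exp_untilt _ r)

theorem exists_untilt_momentWeight_eq (ht : 0 ≤ t) (y₀ : E) {p : ProbabilityMeasure E}
    (hp : MemPt t p) : ∃ r, untilt (momentWeight ht y₀) r = p :=
  exists_untilt_eq _ p ((memPt_iff_integrable ht y₀ p).1 hp)

theorem MemPt.integrable (ht : 0 ≤ t) {p : ProbabilityMeasure E} (hp : MemPt t p) {g : E → ℝ}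
    (hg : g ∈ PhiT t E) : Integrable g (p : Measure E) := by
  have hE : Nonempty E := ⟨hp.choose⟩
  obtain ⟨K, hK⟩ := exists_abs_le_exp_momentWeight ht hE.some hg
  exact (((memPt_iff_integrable ht hE.some p).1 hp).const_mul K).mono'
    hg.1.aestronglyMeasurable (Filter.Eventually.of_forall hK)

theorem mul_exp_momentWeight_mem_PhiT (ht : 0 ≤ t) (y₀ : E) (h : E →ᵇ ℝ) :
    (fun y => h y * Real.exp (momentWeight ht y₀ y)) ∈ PhiT t E := by
  refine ⟨by fun_prop, ‖h‖, y₀, fun y => ?_⟩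
  rw [← exp_momentWeight ht, abs_mul, Real.abs_exp]
  exact mul_le_mul_of_nonneg_right (h.norm_coe_le_norm y) (Real.exp_pos _).le

/-- The map `untilt (momentWeight ht y₀)` with values in `𝒫_t`. -/
def untiltPt (ht : 0 ≤ t) (y₀ : E) (r : ProbabilityMeasure E) : PtSpace t E :=
  ⟨untilt (momentWeight ht y₀) r, memPt_untilt ht y₀ r⟩

theorem continuous_untiltPt (ht : 0 ≤ t) (y₀ : E) : Continuous (untiltPt ht y₀) := by
  refine continuous_iInf_rng.2 fun g => continuous_iInf_rng.2 fun hg =>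
    continuous_induced_rng.2 ?_
  obtain ⟨K, hK⟩ := exists_abs_le_exp_momentWeight ht y₀ hg
  exact continuous_integral_untilt _ hg.1 hK

theorem lowerSemicontinuous_untilt_momentWeight {F : Type*} [TopologicalSpace F] (ht : 0 ≤ t)
    (y₀ : E) {C : F → ProbabilityMeasure E → ℝ≥0∞}
    (hC : LowerSemicontinuous fun q : F × PtSpace t E => C q.1 q.2.1) :
    LowerSemicontinuous fun z : F × ProbabilityMeasure E =>
      C z.1 (untilt (momentWeight ht y₀) z.2) :=
  hC.comp (continuous_fst.prodMk ((continuous_untiltPt ht y₀).comp continuous_snd))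

end MomentWeight

section ELintegral

theorem ERealToENNReal_mono {x y : EReal} (h : x ≤ y) : ERealToENNReal x ≤ ERealToENNReal y :=
  EReal.toENNReal_le_toENNReal h

theorem ERealToENNReal_coe (x : ℝ) : ERealToENNReal (x : EReal) = ENNReal.ofReal x := by
  simp [ERealToENNReal]

theorem ERealToENNReal_add_le {x : EReal} {a : ℝ} {c : ℝ≥0∞} (h : x ≤ (a : EReal) + (c : EReal)) :
    ERealToENNReal x + ENNReal.ofReal (-a) ≤
      ERealToENNReal (-x) + (ENNReal.ofReal a + c) := by
  induction c with
  | top => simp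
  | coe c =>
    induction x with
    | bot => simp [ERealToENNReal]
    | top =>
      rw [EReal.coe_nnreal_eq_coe_real, ← EReal.coe_add] at h
      exact absurd h (not_le.2 (EReal.coe_lt_top _))
    | coe x =>
      rw [EReal.coe_nnreal_eq_coe_real, ← EReal.coe_add, EReal.coe_le_coe_iff] at h
      rw [← EReal.coe_neg, ERealToENNReal_coe, ERealToENNReal_coe,
        ← ENNReal.ofReal_coe_nnreal (p := c)]
      have hmax : ∀ r : ℝ, ENNReal.ofReal r = ENNReal.ofReal (max r 0) :=
          fun r => by simp [ENNReal.ofReal_max]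
      rw [hmax x, hmax (-a), hmax (-x), hmax a, ← ENNReal.ofReal_add (by simp) (by simp),
        ← ENNReal.ofReal_add (by simp) (by simp), ← ENNReal.ofReal_add (by simp) (by positivity)]
      refine ENNReal.ofReal_le_ofReal ?_
      have h1 := max_zero_sub_max_neg_zero_eq_self x
      have h2 := max_zero_sub_max_neg_zero_eq_self a
      linarith

variable {Ω : Type*} [MeasurableSpace Ω] {m : Measure Ω}

theorem le_eLintegral_of_forall_le {f : Ω → ℝ} (hf : Integrable f m) {R : Ω → EReal}
    (h : ∀ x, (f x : EReal) ≤ R x) : ((∫ x, f x ∂m : ℝ) : EReal) ≤ eLintegral m R := by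
  have h1 : ∫⁻ x, ENNReal.ofReal (f x) ∂m ≠ ⊤ := hf.lintegral_lt_top.ne
  have h2 : ∫⁻ x, ENNReal.ofReal (-f x) ∂m ≠ ⊤ := hf.neg.lintegral_lt_top.ne
  rw [integral_eq_lintegral_pos_part_sub_lintegral_neg_part hf, EReal.coe_sub,
    EReal.coe_ennreal_toReal h1, EReal.coe_ennreal_toReal h2]
  refine EReal.sub_le_sub ?_ ?_
  · refine EReal.coe_ennreal_le_coe_ennreal_iff.2 (lintegral_mono fun x => ?_)
    rw [← ERealToENNReal_coe]
    exact ERealToENNReal_mono (h x)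
  · refine EReal.coe_ennreal_le_coe_ennreal_iff.2 (lintegral_mono fun x => ?_)
    dsimp only
    rw [← ERealToENNReal_coe, EReal.coe_neg]
    exact ERealToENNReal_mono (EReal.neg_le_neg_iff.2 (h x))

theorem neg_integral_add_eLintegral_le {G : Ω → ℝ} (hG : Integrable G m) {c : Ω → ℝ≥0∞}
    (hc : AEMeasurable c m) {R : Ω → EReal} (h : ∀ᵐ x ∂m, R x ≤ (G x : EReal) + (c x : EReal)) :
    -((∫ x, G x ∂m : ℝ) : EReal) + eLintegral m R ≤ ((∫⁻ x, c x ∂m : ℝ≥0∞) : EReal) := by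
  have h1 : ∫⁻ x, ENNReal.ofReal (G x) ∂m ≠ ⊤ := hG.lintegral_lt_top.ne
  have h2 : ∫⁻ x, ENNReal.ofReal (-G x) ∂m ≠ ⊤ := hG.neg.lintegral_lt_top.ne
  have hGm : AEMeasurable (fun x => ENNReal.ofReal (G x)) m :=
    hG.aemeasurable.ennreal_ofReal
  have hGm' : AEMeasurable (fun x => ENNReal.ofReal (-G x)) m :=
    hG.aemeasurable.neg.ennreal_ofReal
  have hle : ∫⁻ x, ERealToENNReal (R x) ∂m + ∫⁻ x, ENNReal.ofReal (-G x) ∂m ≤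
      ∫⁻ x, ERealToENNReal (-R x) ∂m +
        (∫⁻ x, ENNReal.ofReal (G x) ∂m + ∫⁻ x, c x ∂m) := by
    rw [← lintegral_add_right' _ hGm', ← lintegral_add_left' hGm,
      ← lintegral_add_right' (g := fun x => ENNReal.ofReal (G x) + c x) _ (hGm.add hc)]
    exact lintegral_mono_ae (h.mono fun x hx => ERealToENNReal_add_le hx)
  rw [integral_eq_lintegral_pos_part_sub_lintegral_neg_part hG, eLintegral]
  generalize ∫⁻ x, ERealToENNReal (R x) ∂m = A at *
  generalize ∫⁻ x, ERealToENNReal (-R x) ∂m = B at *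
  generalize ∫⁻ x, ENNReal.ofReal (G x) ∂m = p at *
  generalize ∫⁻ x, ENNReal.ofReal (-G x) ∂m = n at *
  generalize ∫⁻ x, c x ∂m = s at *
  lift p to ℝ≥0 using h1
  lift n to ℝ≥0 using h2
  rcases eq_or_ne B ⊤ with rfl | hB
  · simp [sub_eq_add_neg]
  rcases eq_or_ne s ⊤ with rfl | hs
  · simp
  lift B to ℝ≥0 using hB
  lift s to ℝ≥0 using hs
  have hA : A ≠ ⊤ := by
    rintro rfl
    rw [top_add, top_le_iff] at hle
    exact absurd hle (by simp)
  lift A to ℝ≥0 using hA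
  have hle' : (A : ℝ) + n ≤ B + (p + s) := by exact_mod_cast hle
  simp only [EReal.coe_nnreal_eq_coe_real, ENNReal.coe_toReal]
  rw [← EReal.coe_sub, ← EReal.coe_neg, ← EReal.coe_add, EReal.coe_le_coe_iff]
  linarith

end ELintegral

section Duality

open Topology Filter BoundedContinuousFunction

variable {E F : Type*} [MetricSpace E] [PolishSpace E] [MeasurableSpace E] [BorelSpace E]
  [MetricSpace F] [PolishSpace F] [MeasurableSpace F] [BorelSpace F] {t : ℝ}

theorem max_neg_const_mem_PhiT {g : E → ℝ} (hg : g ∈ PhiT t E) (k : ℝ) :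
    (fun y => max (g y) (-k)) ∈ PhiT t E := by
  obtain ⟨hc, K, z, hK⟩ := hg
  refine ⟨hc.max continuous_const, K + |k|, z, fun y => ?_⟩
  have := Real.rpow_nonneg (dist_nonneg (x := y) (y := z)) t
  have h1 : |max (g y) (-k)| ≤ max |g y| |-k| := abs_max_le_max_abs_abs
  have h2 : max |g y| |-k| ≤ |g y| + |k| := by
    rw [abs_neg]
    exact max_le (by linarith [abs_nonneg k]) (by linarith [abs_nonneg (g y)])
  nlinarith [hK y, abs_nonneg k, mul_nonneg (abs_nonneg k) this]

theorem exists_integral_max_neg_lt {p : Measure E} {g : E → ℝ} (hgc : Continuous g)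
    (hg : Integrable g p) {β : ℝ} (hβ : ∫ y, g y ∂p < β) :
    ∃ k : ℕ, ∫ y, max (g y) (-(k : ℝ)) ∂p < β := by
  have h : Tendsto (fun k : ℕ => ∫ y, max (g y) (-(k : ℝ)) ∂p) atTop (𝓝 (∫ y, g y ∂p)) := by
    refine tendsto_integral_of_dominated_convergence (fun y => |g y|)
      (fun k => (hgc.max continuous_const).aestronglyMeasurable) hg.abs
      (fun k => Eventually.of_forall fun y => ?_) (Eventually.of_forall fun y => ?_)
    · have hk : (0 : ℝ) ≤ k := k.cast_nonneg
      rw [Real.norm_eq_abs, abs_le]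
      exact ⟨(neg_abs_le _).trans (le_max_left _ _),
        max_le (le_abs_self _) (by linarith [abs_nonneg (g y)])⟩
    · obtain ⟨N, hN⟩ := exists_nat_ge (-g y)
      refine tendsto_const_nhds.congr' ?_
      filter_upwards [eventually_ge_atTop N] with k hk
      have : (N : ℝ) ≤ k := by exact_mod_cast hk
      exact (max_eq_left (by linarith)).symm
  exact (h.eventually_lt_const hβ).exists

theorem injective_untilt (v : C(E, ℝ≥0)) : Function.Injective (untilt v) := by
  intro q q' h
  refine (isInducing_untiltPairing v).injective ?_
  funext g
  rw [untiltPairing_apply, untiltPairing_apply, h]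

variable [Nonempty E]

theorem weakValue_le_relaxedValue (ht : 0 ≤ t) (y₀ : E) {C : F → ProbabilityMeasure E → ℝ≥0∞}
    (hlsc : LowerSemicontinuous fun q : F × PtSpace t E => C q.1 q.2.1)
    (hconv : ∀ x : F, ∀ p q r : ProbabilityMeasure E, MemPt t p → MemPt t q →
      ∀ a b : ℝ≥0, a + b = 1 →
      (r : Measure E) = (a : ℝ≥0∞) • (p : Measure E) + (b : ℝ≥0∞) • (q : Measure E) →
      C x r ≤ (a : ℝ≥0∞) * C x p + (b : ℝ≥0∞) * C x q)
    (μ : ProbabilityMeasure F) {ν : ProbabilityMeasure E} (hν : MemPt t ν) :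
    weakValue C μ ν ≤ relaxedValue (momentWeight ht y₀)
      (fun z : F × ProbabilityMeasure E => C z.1 (untilt (momentWeight ht y₀) z.2)) μ ν := by
  refine le_iInf fun P => ?_
  obtain ⟨π, h1, h2, h3⟩ := exists_coupling_lintegral_le (momentWeight ht y₀) (W := C)
    (lowerSemicontinuous_untilt_momentWeight ht y₀ hlsc)
    (fun x r₁ r₂ r a b hab hr => hconv x _ _ _ (memPt_untilt ht y₀ r₁) (memPt_untilt ht y₀ r₂)
      a b hab (by rw [hr, toMeasure_mixture])) P.1
    (by rw [P.2.2]; exact (memPt_iff_integrable ht y₀ ν).1 hν)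
  rw [P.2.1] at h1 h3
  rw [P.2.2] at h2
  exact (iInf₂_le π ⟨h1, h2⟩).trans h3

theorem exists_dual_ge (ht : 0 ≤ t) {C : F → ProbabilityMeasure E → ℝ≥0∞}
    (hlsc : LowerSemicontinuous fun q : F × PtSpace t E => C q.1 q.2.1)
    (hconv : ∀ x : F, ∀ p q r : ProbabilityMeasure E, MemPt t p → MemPt t q →
      ∀ a b : ℝ≥0, a + b = 1 →
      (r : Measure E) = (a : ℝ≥0∞) • (p : Measure E) + (b : ℝ≥0∞) • (q : Measure E) →
      C x r ≤ (a : ℝ≥0∞) * C x p + (b : ℝ≥0∞) * C x q)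
    (μ : ProbabilityMeasure F) {ν : ProbabilityMeasure E} (hν : MemPt t ν) {α : ℝ}
    (hα : ENNReal.ofReal α < weakValue C μ ν) :
    ∃ g ∈ PhiT t E, (∃ c : ℝ, ∀ y, c ≤ g y) ∧
      (α : EReal) ≤ -((∫ y, g y ∂(ν : Measure E) : ℝ) : EReal) +
        eLintegral (μ : Measure F) (RC t C g) := by
  let y₀ : E := Classical.arbitrary E
  obtain ⟨r, hr⟩ := exists_untilt_momentWeight_eq ht y₀ hν
  have hα' := hα.trans_le (weakValue_le_relaxedValue ht y₀ hlsc hconv μ hν)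
  rw [← hr] at hα'
  obtain ⟨f, h, hle, hlt⟩ := exists_pairing_minorant (momentWeight ht y₀)
    (lowerSemicontinuous_untilt_momentWeight ht y₀ hlsc) μ r α hα'
  have hmem := mul_exp_momentWeight_mem_PhiT ht y₀ (-h)
  set g : E → ℝ := fun y => (-h) y * Real.exp (momentWeight ht y₀ y) with hg
  have hgint : ∀ q, ∫ y, g y ∂(untilt (momentWeight ht y₀) q : Measure E) =
      -untiltPairing (momentWeight ht y₀) q h := fun q => by
    rw [← map_neg, untiltPairing_apply]
  have hβ : ∫ y, g y ∂(ν : Measure E) < ∫ x, f x ∂(μ : Measure F) - α := by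
    rw [← hr, hgint]
    linarith
  obtain ⟨k, hk⟩ := exists_integral_max_neg_lt hmem.1 (hν.integrable ht hmem) hβ
  have hmem' := max_neg_const_mem_PhiT hmem k
  refine ⟨_, hmem', ⟨-k, fun y => le_max_right _ _⟩, ?_⟩
  have hRC : ∀ x, (f x : EReal) ≤ RC t C (fun y => max (g y) (-(k : ℝ))) x := fun x => by
    refine le_iInf₂ fun p hp => ?_
    obtain ⟨q, rfl⟩ := exists_untilt_momentWeight_eq ht y₀ hp
    have h1 : ∫ y, g y ∂(untilt (momentWeight ht y₀) q : Measure E) ≤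
        ∫ y, max (g y) (-(k : ℝ)) ∂(untilt (momentWeight ht y₀) q : Measure E) :=
      integral_mono (hp.integrable ht hmem) (hp.integrable ht hmem') fun y => le_max_left _ _
    rw [hgint] at h1
    have h2 : ((f x + untiltPairing (momentWeight ht y₀) q h : ℝ) : EReal) ≤
        ((C x (untilt (momentWeight ht y₀) q) : ℝ≥0∞) : EReal) :=
      le_trans (by rw [EReal.coe_ennreal_ofReal]; exact EReal.coe_le_coe_iff.2 (le_max_left _ _))
        (EReal.coe_ennreal_le_coe_ennreal_iff.2 (hle x q))
    calc (f x : EReal) = ((-untiltPairing (momentWeight ht y₀) q h : ℝ) : EReal) +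
          ((f x + untiltPairing (momentWeight ht y₀) q h : ℝ) : EReal) := by
          rw [← EReal.coe_add]
          congr 1
          ring
      _ ≤ _ := add_le_add (EReal.coe_le_coe_iff.2 h1) h2
  refine le_trans ?_ (add_le_add_right (le_eLintegral_of_forall_le (integrable_bcf μ f) hRC) _)
  rw [← EReal.coe_neg, ← EReal.coe_add, EReal.coe_le_coe_iff]
  linarith

theorem dual_le_weakCost (ht : 0 ≤ t) {C : F → ProbabilityMeasure E → ℝ≥0∞}
    (hlsc : LowerSemicontinuous fun q : F × PtSpace t E => C q.1 q.2.1)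
    {μ : ProbabilityMeasure F} {ν : ProbabilityMeasure E} (hν : MemPt t ν)
    {π : ProbabilityMeasure (F × E)} (hπ : IsCoupling μ ν π) {g : E → ℝ} (hg : g ∈ PhiT t E) :
    -((∫ y, g y ∂(ν : Measure E) : ℝ) : EReal) + eLintegral (μ : Measure F) (RC t C g) ≤
      ((weakCost C μ π : ℝ≥0∞) : EReal) := by
  let y₀ : E := Classical.arbitrary E
  have : Nonempty (ProbabilityMeasure E) := ⟨ν⟩
  have hdis : (μ : Measure F) ⊗ₘ (π : Measure (F × E)).condKernel = π := by
    rw [← hπ.1]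
    exact Measure.disintegrate _ _
  have hint : ∀ {f : E → ℝ}, Continuous f → Integrable f (ν : Measure E) →
      Integrable (fun z : F × E => f z.2) ((μ : Measure F) ⊗ₘ (π : Measure (F × E)).condKernel) :=
    fun {f} hfc hf => by
      rw [hdis]
      rw [← hπ.2] at hf
      exact hf.comp_measurable measurable_snd
  have hexp := hint (by fun_prop) ((memPt_iff_integrable ht y₀ ν).1 hν)
  have hmem : ∀ᵐ x ∂(μ : Measure F), MemPt t (disint π x) := by
    filter_upwards [((Measure.integrable_compProd_iff hexp.1).1 hexp).1] with x hx
    exact (memPt_iff_integrable ht y₀ _).2 hx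
  have hgint := hint hg.1 (hν.integrable ht hg)
  have hG : Integrable (fun x => ∫ y, g y ∂(disint π x : Measure E)) (μ : Measure F) :=
    Integrable.integral_compProd (κ := Kernel.const Unit (μ : Measure F)) (a := ()) hgint
  have hνG : ∫ y, g y ∂(ν : Measure E) =
      ∫ x, ∫ y, g y ∂(disint π x : Measure E) ∂(μ : Measure F) := by
    rw [← hπ.2, integral_map measurable_snd.aemeasurable hg.1.aestronglyMeasurable]
    conv_lhs => rw [← hdis]
    exact Measure.integral_compProd hgint
  have hmeas : Measurable (disint π) :=
    Measurable.subtype_mk (π : Measure (F × E)).condKernel.measurable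
  have hemb := (measurable_untilt (momentWeight ht y₀)).measurableEmbedding
    (injective_untilt (momentWeight ht y₀))
  have hC : AEMeasurable (fun x => C x (disint π x)) (μ : Measure F) := by
    refine ⟨fun x => C x (untilt (momentWeight ht y₀) (hemb.invFun (disint π x))), ?_, ?_⟩
    · exact (lowerSemicontinuous_untilt_momentWeight ht y₀ hlsc).measurable.comp
        (measurable_id.prodMk (hemb.measurable_invFun.comp hmeas))
    · filter_upwards [hmem] with x hx
      obtain ⟨r, hr⟩ := exists_untilt_momentWeight_eq ht y₀ hx
      rw [← hr, hemb.leftInverse_invFun r]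
  rw [hνG]
  refine neg_integral_add_eLintegral_le hG hC ?_
  filter_upwards [hmem] with x hx
  exact iInf₂_le (disint π x) hx

end Duality

/-- Duality for the weak transport problem in inf-convolution form, together with the fact that
the supremum may be restricted to functions in `Φ_t(Y)` that are bounded from below. -/
theorem weak_transport_duality_infConvolution
    (t : ℝ) (ht : 1 ≤ t) (C : X → ProbabilityMeasure Y → ℝ≥0∞)
    (hlsc : LowerSemicontinuous fun q : X × PtSpace t Y => C q.1 q.2.1)
    (hconv : ∀ x : X, ∀ p q r : ProbabilityMeasure Y, MemPt t p → MemPt t q →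
      ∀ a b : ℝ≥0, a + b = 1 →
      (r : Measure Y) = (a : ℝ≥0∞) • (p : Measure Y) + (b : ℝ≥0∞) • (q : Measure Y) →
      C x r ≤ (a : ℝ≥0∞) * C x p + (b : ℝ≥0∞) * C x q)
    (μ : ProbabilityMeasure X) (ν : ProbabilityMeasure Y) (hν : MemPt t ν) :
    ((weakValue C μ ν : ℝ≥0∞) : EReal) =
      (⨆ (g : Y → ℝ) (_ : g ∈ PhiT t Y),
        (-((∫ y, g y ∂(ν : Measure Y) : ℝ) : EReal) +
          eLintegral (μ : Measure X) (RC t C g))) ∧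
    ((weakValue C μ ν : ℝ≥0∞) : EReal) =
      (⨆ (g : Y → ℝ) (_ : g ∈ PhiT t Y) (_ : ∃ c : ℝ, ∀ y, c ≤ g y),
        (-((∫ y, g y ∂(ν : Measure Y) : ℝ) : EReal) +
          eLintegral (μ : Measure X) (RC t C g))) := by
  have ht0 : 0 ≤ t := zero_le_one.trans ht
  have hupper : (⨆ (g : Y → ℝ) (_ : g ∈ PhiT t Y), (-((∫ y, g y ∂(ν : Measure Y) : ℝ) : EReal) +
      eLintegral (μ : Measure X) (RC t C g))) ≤ ((weakValue C μ ν : ℝ≥0∞) : EReal) := by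
    refine iSup₂_le fun g hg => ((le_max_right _ _).trans
      EReal.coe_toENNReal_eq_max.ge).trans
      (EReal.coe_ennreal_le_coe_ennreal_iff.2 (le_iInf₂ fun π hπ => ?_))
    exact (EReal.toENNReal_le_toENNReal (dual_le_weakCost ht0 hlsc hν hπ hg)).trans
      EReal.toENNReal_coe.le
  have hmono : (⨆ (g : Y → ℝ) (_ : g ∈ PhiT t Y) (_ : ∃ c : ℝ, ∀ y, c ≤ g y),
      (-((∫ y, g y ∂(ν : Measure Y) : ℝ) : EReal) + eLintegral (μ : Measure X) (RC t C g))) ≤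
      ⨆ (g : Y → ℝ) (_ : g ∈ PhiT t Y), (-((∫ y, g y ∂(ν : Measure Y) : ℝ) : EReal) +
        eLintegral (μ : Measure X) (RC t C g)) :=
    iSup₂_mono fun g hg => iSup_le fun _ => le_rfl
  have hlower : ((weakValue C μ ν : ℝ≥0∞) : EReal) ≤
      ⨆ (g : Y → ℝ) (_ : g ∈ PhiT t Y) (_ : ∃ c : ℝ, ∀ y, c ≤ g y),
        (-((∫ y, g y ∂(ν : Measure Y) : ℝ) : EReal) +
          eLintegral (μ : Measure X) (RC t C g)) := by
    refine EReal.ge_of_forall_gt_iff_ge.1 fun α hα => ?_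
    rcases lt_or_ge α 0 with hneg | hpos
    · have h0 : (0 : Y → ℝ) ∈ PhiT t Y :=
        ⟨continuous_const, 0, Classical.arbitrary Y, fun y => by simp⟩
      refine le_iSup_of_le 0 (le_iSup_of_le h0 (le_iSup_of_le ⟨0, fun y => le_rfl⟩ ?_))
      have h1 := le_eLintegral_of_forall_le (m := (μ : Measure X)) (R := RC t C 0)
        (integrable_zero X ℝ _) fun x => le_iInf₂ fun p _ => by
          simp [EReal.coe_ennreal_nonneg]
      refine (EReal.coe_le_coe_iff.2 hneg.le).trans ?_
      simpa using h1
    · have hα' : ENNReal.ofReal α < weakValue C μ ν := by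
        rwa [← EReal.coe_ennreal_lt_coe_ennreal_iff, EReal.coe_ennreal_ofReal, max_eq_left hpos]
      obtain ⟨g, hg, hb, hle⟩ := exists_dual_ge ht0 hlsc hconv μ hν hα'
      exact le_iSup_of_le g (le_iSup_of_le hg (le_iSup_of_le hb hle))
  exact ⟨le_antisymm (hlower.trans hmono) hupper, le_antisymm hlower (hmono.trans hupper)⟩

end
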